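/- Let K ⊂ ℝ^{n+1} be a smooth, strictly convex, origin-centred body (centroid of K at the origin) with support function h and Gauss curvature 𝒦, and let X = Dh, dV = h σ_n dμ. Then ∫_{S^n} ⟨h X, ∇̄ log(h^{n+2}/𝒦)⟩ dV = ∫_{S^n} (n|∇̄h|² − h Δ̄h) dV ≤ 0. -/

import Mathlib

open MeasureTheory Metric
open scoped RealInnerProductSpace ENNReal

noncomputable section

abbrev E (n : ℕ) : Type := EuclideanSpace ℝ (Fin (n + 1))

/-- The Hessian of `H` as a continuous linear map. -/
def hess {n : ℕ} (H : E n → ℝ) (x : E n) : E n →L[ℝ] E n :=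
  fderiv ℝ (gradient H) x

/-- The rank-one projection `y ↦ ⟪x, y⟫ • x`. -/
def proj {n : ℕ} (x : E n) : E n →L[ℝ] E n :=
  ((innerSL ℝ) x).smulRight x

/-- `σ_n = det(∇̄²h + h ḡ)/det ḡ = 1/𝒦`, computed as the determinant of
`D²H + x ⊗ x` where `H` is the 1-homogeneous extension of the support function. -/
def sigmaDet {n : ℕ} (H : E n → ℝ) (x : E n) : ℝ :=
  LinearMap.det ((hess H x + proj x) : E n →L[ℝ] E n).toLinearMap

/-- Tangential (spherical) gradient of the restriction to the unit sphere. -/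
def tgrad {n : ℕ} (F : E n → ℝ) (x : E n) : E n :=
  gradient F x - ⟪gradient F x, x⟫ • x

/-- The convex body with support function `H`. -/
def body {n : ℕ} (H : E n → ℝ) : Set (E n) :=
  {y | ∀ x ∈ sphere (0 : E n) 1, ⟪y, x⟫ ≤ H x}

section PrekopaLeindler

open Set Filter Topology

lemma volume_add_le_of_isCompact {K L C : Set ℝ} (hK : IsCompact K) (hL : IsCompact L)
    (hKn : K.Nonempty) (hLn : L.Nonempty)
    (h : ∀ a ∈ K, ∀ b ∈ L, (a + b) / 2 ∈ C) : volume K + volume L ≤ 2 * volume C := by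
  obtain ⟨α, hα, hαK⟩ := hK.exists_isGreatest hKn
  obtain ⟨β, hβ, hβL⟩ := hL.exists_isLeast hLn
  set S := (fun x : ℝ => 2 * x) ⁻¹' ((fun x => x - β) ⁻¹' K)
  set T := (fun x : ℝ => 2 * x) ⁻¹' ((fun x => x - α) ⁻¹' L)
  have hvol (c : ℝ) (M : Set ℝ) :
      2 * volume ((fun x : ℝ => 2 * x) ⁻¹' ((fun x => x - c) ⁻¹' M)) = volume M := by
    rw [Real.volume_preimage_mul_left two_ne_zero]
    simp only [sub_eq_add_neg]
    rw [measure_preimage_add_right, ← mul_assoc]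
    have : (2 : ℝ≥0∞) * ENNReal.ofReal |2⁻¹| = 1 := by
      rw [abs_of_pos (by norm_num), ENNReal.ofReal_inv_of_pos (by norm_num)]
      simpa using ENNReal.mul_inv_cancel two_ne_zero ENNReal.ofNat_ne_top
    rw [this, one_mul]
  have hST : AEDisjoint volume S T := by
    refine measure_mono_null (t := {(α + β) / 2}) ?_ (by simp)
    rintro x ⟨hx, hx'⟩
    have h₁ := hαK hx
    have h₂ := hβL hx'
    simp only [mem_singleton_iff]
    linarith
  have hTm : MeasurableSet T :=
    (hL.measurableSet.preimage (by fun_prop)).preimage (by fun_prop)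
  calc volume K + volume L = 2 * (volume S + volume T) := by
        rw [mul_add, hvol, hvol]
    _ = 2 * volume (S ∪ T) := by rw [measure_union₀ hTm.nullMeasurableSet hST]
    _ ≤ 2 * volume C := by
        gcongr
        rintro x (hx | hx)
        · simpa using h _ hx _ hβ
        · simpa using h _ hα _ hx

lemma volume_add_le {A B C : Set ℝ} (hA : MeasurableSet A) (hB : MeasurableSet B)
    (hAn : A.Nonempty) (hBn : B.Nonempty)
    (h : ∀ a ∈ A, ∀ b ∈ B, (a + b) / 2 ∈ C) : volume A + volume B ≤ 2 * volume C := by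
  obtain ⟨a₀, ha₀⟩ := hAn
  obtain ⟨b₀, hb₀⟩ := hBn
  have key : ∀ K ⊆ A, IsCompact K → ∀ L ⊆ B, IsCompact L →
      volume K + volume L ≤ 2 * volume C := fun K hKA hK L hLB hL =>
    calc volume K + volume L ≤ volume (insert a₀ K) + volume (insert b₀ L) := by
          gcongr <;> exact subset_insert _ _
      _ ≤ _ := volume_add_le_of_isCompact (hK.insert _) (hL.insert _) (insert_nonempty _ _)
          (insert_nonempty _ _) fun a ha b hb =>
            h a (insert_subset ha₀ hKA ha) b (insert_subset hb₀ hLB hb)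
  rw [hA.measure_eq_iSup_isCompact, hB.measure_eq_iSup_isCompact]
  simp only [iSup_and', iSup_subtype']
  have : Nonempty {i : Set ℝ // i ⊆ A ∧ IsCompact i} := ⟨∅, by simp⟩
  have : Nonempty {i : Set ℝ // i ⊆ B ∧ IsCompact i} := ⟨∅, by simp⟩
  exact ENNReal.iSup_add_iSup_le fun K L => key K K.2.1 K.2.2 L L.2.1 L.2.2

lemma four_mul_le_sq (a b : ℝ≥0∞) : 4 * (a * b) ≤ (a + b) ^ 2 := by
  rcases eq_or_ne a ⊤ with rfl | ha
  · simp
  rcases eq_or_ne b ⊤ with rfl | hb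
  · simp
  lift a to NNReal using ha
  lift b to NNReal using hb
  norm_cast
  have := four_mul_le_sq_add (a : ℝ) b
  rw [← NNReal.coe_le_coe]
  push_cast
  linarith

lemma lintegral_eq_lintegral_superlevel {f : ℝ → ℝ≥0∞} (hf : Measurable f) (h1 : ∀ x, f x ≤ 1) :
    ∫⁻ x, f x = ∫⁻ t in Ioi (0 : ℝ), volume {x | t < (f x).toReal} := by
  rw [← lintegral_eq_lintegral_meas_lt _ (Eventually.of_forall fun x => ENNReal.toReal_nonneg)
    hf.ennreal_toReal.aemeasurable]
  refine lintegral_congr fun x => ?_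
  rw [ENNReal.ofReal_toReal (ne_top_of_le_ne_top ENNReal.one_ne_top (h1 x))]

lemma lintegral_mul_le_sq_of_iSup_eq_one {f g h : ℝ → ℝ≥0∞} (hf : Measurable f)
    (hg : Measurable g) (hh : Measurable h) (hfs : ⨆ x, f x = 1) (hgs : ⨆ x, g x = 1)
    (hfgh : ∀ x y, f x * g y ≤ h ((x + y) / 2) ^ 2) :
    (∫⁻ x, f x) * ∫⁻ x, g x ≤ (∫⁻ x, h x) ^ 2 := by
  have hf1 x : f x ≤ 1 := hfs ▸ le_iSup f x
  have hg1 x : g x ≤ 1 := hgs ▸ le_iSup g x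
  have hm1 x : min (h x) 1 ≤ 1 := min_le_right _ _
  have fin {x : ℝ≥0∞} (hx : x ≤ 1) : x ≠ ⊤ := ne_top_of_le_ne_top ENNReal.one_ne_top hx
  have hsum : (∫⁻ x, f x) + ∫⁻ x, g x ≤ 2 * ∫⁻ x, h x := by
    calc (∫⁻ x, f x) + ∫⁻ x, g x
        ≤ 2 * ∫⁻ x, min (h x) 1 := ?_
      _ ≤ 2 * ∫⁻ x, h x := by
        gcongr
        exact min_le_left _ _
    rw [lintegral_eq_lintegral_superlevel hf hf1, lintegral_eq_lintegral_superlevel hg hg1,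
      lintegral_eq_lintegral_superlevel (hh.min measurable_const) hm1, ← lintegral_const_mul',
      ← lintegral_add_left']
    · refine setLIntegral_mono' measurableSet_Ioi fun t ht => ?_
      rcases lt_or_ge t 1 with ht1 | ht1
      · have ne {u : ℝ → ℝ≥0∞} (hus : ⨆ x, u x = 1) (hu1 : ∀ x, u x ≤ 1) :
            {x | t < (u x).toReal}.Nonempty := by
          have : ENNReal.ofReal t < ⨆ x, u x := by
            rw [hus]; simpa using ht1
          obtain ⟨x, hx⟩ := lt_iSup_iff.1 this
          exact ⟨x, (ENNReal.ofReal_lt_iff_lt_toReal (le_of_lt ht) (fin (hu1 x))).1 hx⟩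
        refine volume_add_le (measurableSet_lt measurable_const hf.ennreal_toReal)
          (measurableSet_lt measurable_const hg.ennreal_toReal) (ne hfs hf1) (ne hgs hg1) ?_
        intro a ha b hb
        have h0 : (0 : ℝ) < t := ht
        have h1 : f a * g b ≤ (min (h ((a + b) / 2)) 1) ^ 2 := by
          rcases le_total (h ((a + b) / 2)) 1 with h' | h'
          · rw [min_eq_left h']; exact hfgh a b
          · rw [min_eq_right h']
            simpa using mul_le_mul' (hf1 a) (hg1 b)
        have h2 : (f a).toReal * (g b).toReal ≤ (min (h ((a + b) / 2)) 1).toReal ^ 2 := by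
          rw [← ENNReal.toReal_mul, ← ENNReal.toReal_pow]
          exact ENNReal.toReal_mono (ENNReal.pow_ne_top (fin (hm1 _))) h1
        simp only [mem_ofPred_eq] at ha hb ⊢
        have h3 : t * t < (f a).toReal * (g b).toReal := mul_lt_mul'' ha hb h0.le h0.le
        exact lt_of_pow_lt_pow_left₀ 2 ENNReal.toReal_nonneg (by nlinarith)
      · have em {u : ℝ → ℝ≥0∞} (hu1 : ∀ x, u x ≤ 1) : {x | t < (u x).toReal} = ∅ := by
          refine eq_empty_of_forall_notMem fun x hx => ?_
          have : (u x).toReal ≤ 1 := by simpa using ENNReal.toReal_mono ENNReal.one_ne_top (hu1 x)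
          simp only [mem_ofPred_eq] at hx
          linarith
        simp [em hf1, em hg1]
    · exact (Antitone.measurable (f := fun t : ℝ => volume {x | t < (f x).toReal}) fun s t hst =>
        measure_mono fun x hx => lt_of_le_of_lt hst hx).aemeasurable
    · exact ENNReal.ofNat_ne_top
  have h4 := (four_mul_le_sq (∫⁻ x, f x) (∫⁻ x, g x)).trans (pow_le_pow_left' hsum 2)
  rw [mul_pow, show (2 : ℝ≥0∞) ^ 2 = 4 by norm_num] at h4
  exact (ENNReal.mul_le_mul_iff_right (by norm_num) (by norm_num)).1 h4

lemma lintegral_mul_le_sq_of_bounded {f g h : ℝ → ℝ≥0∞} (hf : Measurable f)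
    (hg : Measurable g) (hh : Measurable h) (hfs : ⨆ x, f x ≠ ⊤) (hgs : ⨆ x, g x ≠ ⊤)
    (hfgh : ∀ x y, f x * g y ≤ h ((x + y) / 2) ^ 2) :
    (∫⁻ x, f x) * ∫⁻ x, g x ≤ (∫⁻ x, h x) ^ 2 := by
  set a := ⨆ x, f x with ha
  set b := ⨆ x, g x with hb
  rcases eq_or_ne a 0 with ha0 | ha0
  · have : ∀ x, f x = 0 := by simpa [ha] using ha0
    simp [this]
  rcases eq_or_ne b 0 with hb0 | hb0
  · have : ∀ x, g x = 0 := by simpa [hb] using hb0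
    simp [this]
  set c := (a * b) ^ (1 / 2 : ℝ) with hc
  have hc2 : c ^ 2 = a * b := by
    rw [hc, ← ENNReal.rpow_natCast, ← ENNReal.rpow_mul]; norm_num
  have hc0 : c ≠ 0 := by
    intro h; rw [h] at hc2; simp at hc2; exact (hc2.elim ha0 hb0)
  have hct : c ≠ ⊤ := by
    intro h; rw [h] at hc2; simp at hc2
    exact (ENNReal.mul_ne_top hfs hgs) hc2.symm
  have key := lintegral_mul_le_sq_of_iSup_eq_one (f := fun x => a⁻¹ * f x)
    (g := fun x => b⁻¹ * g x) (h := fun x => c⁻¹ * h x) (hf.const_mul _) (hg.const_mul _)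
    (hh.const_mul _) (by rw [← ENNReal.mul_iSup, ← ha, ENNReal.inv_mul_cancel ha0 hfs])
    (by rw [← ENNReal.mul_iSup, ← hb, ENNReal.inv_mul_cancel hb0 hgs]) (fun x y => by
      rw [mul_pow, ← ENNReal.inv_pow, hc2, ENNReal.mul_inv (.inl ha0) (.inl hfs)]
      calc _ = (a⁻¹ * b⁻¹) * (f x * g y) := by ring
        _ ≤ _ := by gcongr; exact hfgh x y)
  rw [lintegral_const_mul _ hf, lintegral_const_mul _ hg, lintegral_const_mul _ hh, mul_pow,
    ← ENNReal.inv_pow, hc2, mul_mul_mul_comm, ← ENNReal.mul_inv (.inl ha0) (.inl hfs)] at key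
  exact (ENNReal.mul_le_mul_iff_right (ENNReal.inv_ne_zero.2 (ENNReal.mul_ne_top hfs hgs))
    (ENNReal.inv_ne_top.2 (mul_ne_zero ha0 hb0))).1 key

/-- The Prékopa–Leindler inequality on the line, at the midpoint. -/
theorem prekopa_leindler_real {f g h : ℝ → ℝ≥0∞} (hf : Measurable f)
    (hg : Measurable g) (hh : Measurable h)
    (hfgh : ∀ x y, f x * g y ≤ h ((x + y) / 2) ^ 2) :
    (∫⁻ x, f x) * ∫⁻ x, g x ≤ (∫⁻ x, h x) ^ 2 := by
  have approx {u : ℝ → ℝ≥0∞} (hu : Measurable u) :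
      ∫⁻ x, u x = ⨆ k : ℕ, ∫⁻ x, min (u x) k := by
    rw [← lintegral_iSup (fun k => hu.min measurable_const)
      (fun i j hij x => min_le_min le_rfl (by exact_mod_cast hij))]
    refine lintegral_congr fun x => ?_
    rw [← inf_iSup_eq, ENNReal.iSup_natCast, inf_top_eq]
  rw [approx hf, approx hg, ENNReal.iSup_mul]
  refine iSup_le fun k => ?_
  rw [ENNReal.mul_iSup]
  refine iSup_le fun l => ?_
  have bd (u : ℝ → ℝ≥0∞) (k : ℕ) : ⨆ x, min (u x) k ≠ ⊤ :=
    ne_top_of_le_ne_top (ENNReal.natCast_ne_top k) (iSup_le fun x => min_le_right _ _)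
  exact lintegral_mul_le_sq_of_bounded (hf.min measurable_const) (hg.min measurable_const) hh
    (bd f k) (bd g l) fun x y =>
      (mul_le_mul' (min_le_left _ _) (min_le_left _ _)).trans (hfgh x y)

/-- The Prékopa–Leindler inequality on `ℝⁿ`, at the midpoint. -/
theorem prekopa_leindler_pi (n : ℕ) {f g h : (Fin n → ℝ) → ℝ≥0∞} (hf : Measurable f)
    (hg : Measurable g) (hh : Measurable h)
    (hfgh : ∀ x y, f x * g y ≤ h ((1 / 2 : ℝ) • (x + y)) ^ 2) :
    (∫⁻ x, f x) * ∫⁻ x, g x ≤ (∫⁻ x, h x) ^ 2 := by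
  induction n with
  | zero =>
    have key (u : (Fin 0 → ℝ) → ℝ≥0∞) : ∫⁻ x, u x = u 0 := by
      rw [Measure.volume_pi_eq_dirac 0]
      exact lintegral_dirac _ _
    rw [key, key, key]
    convert hfgh 0 0 using 3
  | succ n ih =>
    have mp := (volume_preserving_piFinSuccAbove (fun _ : Fin (n + 1) => ℝ) 0).symm
    have key {u : (Fin (n + 1) → ℝ) → ℝ≥0∞} (hu : Measurable u) :
        Measurable (fun t : ℝ × (Fin n → ℝ) => u (Fin.cons t.1 t.2)) ∧
        ∫⁻ x, u x = ∫⁻ t, ∫⁻ y, u (Fin.cons t y) := by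
      have hm : Measurable (fun t : ℝ × (Fin n → ℝ) => u (Fin.cons t.1 t.2)) := by
        have := hu.comp mp.measurable
        simpa [Function.comp_def, MeasurableEquiv.piFinSuccAbove, Fin.insertNthEquiv] using this
      refine ⟨hm, ?_⟩
      rw [← mp.lintegral_comp hu, Measure.volume_eq_prod,
        ← lintegral_prod (fun t : ℝ × (Fin n → ℝ) => u (Fin.cons t.1 t.2)) hm.aemeasurable]
      simp [MeasurableEquiv.piFinSuccAbove, Fin.insertNthEquiv]
    rw [(key hf).2, (key hg).2, (key hh).2]
    refine prekopa_leindler_real (key hf).1.lintegral_prod_right'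
      (key hg).1.lintegral_prod_right' (key hh).1.lintegral_prod_right' fun t s => ?_
    refine ih ((key hf).1.comp measurable_prodMk_left) ((key hg).1.comp measurable_prodMk_left)
      ((key hh).1.comp measurable_prodMk_left) fun x y => ?_
    convert hfgh (Fin.cons t x) (Fin.cons s y) using 3
    ext i
    refine Fin.cases ?_ (fun j => ?_) i <;> simp [mul_add]
    ring

/-- The Prékopa–Leindler inequality on Euclidean space, at the midpoint. -/
theorem prekopa_leindler {n : ℕ} {f g h : E n → ℝ≥0∞} (hf : Measurable f)
    (hg : Measurable g) (hh : Measurable h)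
    (hfgh : ∀ x y, f x * g y ≤ h ((1 / 2 : ℝ) • (x + y)) ^ 2) :
    (∫⁻ x, f x) * ∫⁻ x, g x ≤ (∫⁻ x, h x) ^ 2 := by
  have mp := PiLp.volume_preserving_toLp (Fin (n + 1))
  rw [← mp.lintegral_comp hf, ← mp.lintegral_comp hg, ← mp.lintegral_comp hh]
  exact prekopa_leindler_pi _ (hf.comp mp.measurable) (hg.comp mp.measurable)
    (hh.comp mp.measurable) fun x y => hfgh _ _

end PrekopaLeindler

section UniformlyDistributed

open Set Filter Topology

variable {X : Type*} [MetricSpace X] [SecondCountableTopology X] [MeasurableSpace X]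

lemma measure_ball_ne_zero_of_uniform {μ : Measure X} [NeZero μ]
    (hμ : ∀ x y r, μ (ball x r) = μ (ball y r)) (x : X) {r : ℝ} (hr : 0 < r) :
    μ (ball x r) ≠ 0 := by
  intro h
  have := measure_null_of_locally_null (μ := μ) univ fun y _ =>
    ⟨ball y r, mem_nhdsWithin_of_mem_nhds (ball_mem_nhds y hr), (hμ y x r).trans h⟩
  exact NeZero.ne μ (Measure.measure_univ_eq_zero.1 this)

variable [BorelSpace X]

lemma measure_isOpen_le_liminf {μ ν : Measure X} [IsFiniteMeasure μ] [IsFiniteMeasure ν]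
    [NeZero ν] (hμ : ∀ x y r, μ (ball x r) = μ (ball y r))
    (hν : ∀ x y r, ν (ball x r) = ν (ball y r)) (x₀ : X) {U : Set X} (hU : IsOpen U)
    {r : ℕ → ℝ} (hr0 : ∀ k, 0 < r k) (hr : Tendsto r atTop (𝓝 0)) :
    μ U ≤ liminf (fun k => (μ (ball x₀ (r k)) / ν (ball x₀ (r k))) * ν U) atTop := by
  set b := fun k => ν (ball x₀ (r k))
  have hb0 k : b k ≠ 0 := measure_ball_ne_zero_of_uniform hν _ (hr0 k)
  have hbt k : b k ≠ ⊤ := measure_ne_top _ _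
  have hD k : MeasurableSet {p : X × X | dist p.1 p.2 < r k} :=
    (isOpen_lt (by fun_prop) (by fun_prop)).measurableSet
  set F : ℕ → X → X → ℝ≥0∞ := fun k x y => {p : X × X | dist p.1 p.2 < r k}.indicator 1 (x, y)
  have hF k : Measurable (Function.uncurry (F k)) := measurable_one.indicator (hD k)
  have hFν k x : ∫⁻ y in U, F k x y ∂ν = ν (ball x (r k) ∩ U) := by
    have : (fun y => F k x y) = (ball x (r k)).indicator 1 := by
      ext y
      simp [F, indicator, mem_ball, dist_comm]
    rw [this, lintegral_indicator_one measurableSet_ball, Measure.restrict_apply measurableSet_ball]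
  have hFμ k y : ∫⁻ x in U, F k x y ∂μ ≤ μ (ball x₀ (r k)) := by
    have : (fun x => F k x y) = (ball y (r k)).indicator 1 := by
      ext x
      simp [F, indicator, mem_ball]
    rw [this, lintegral_indicator_one measurableSet_ball, Measure.restrict_apply measurableSet_ball,
      hμ x₀ y]
    exact measure_mono inter_subset_left
  have hmeas k : Measurable fun x => (b k)⁻¹ * ∫⁻ y in U, F k x y ∂ν :=
    (hF k).lintegral_prod_right'.const_mul _
  calc μ U = ∫⁻ x in U, 1 ∂μ := by simp
    _ ≤ ∫⁻ x in U, liminf (fun k => (b k)⁻¹ * ∫⁻ y in U, F k x y ∂ν) atTop ∂μ := by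
        refine setLIntegral_mono' hU.measurableSet fun x hx => ?_
        refine le_liminf_of_le (by isBoundedDefault) ?_
        obtain ⟨ε, hε, hεU⟩ := Metric.isOpen_iff.1 hU x hx
        filter_upwards [hr.eventually_lt_const hε] with k hk
        rw [hFν, inter_eq_self_of_subset_left ((ball_subset_ball hk.le).trans hεU), hν x x₀]
        exact (ENNReal.inv_mul_cancel (hb0 k) (hbt k)).ge
    _ ≤ liminf (fun k => ∫⁻ x in U, (b k)⁻¹ * ∫⁻ y in U, F k x y ∂ν ∂μ) atTop :=
        lintegral_liminf_le hmeas
    _ ≤ _ := by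
        refine liminf_le_liminf (Eventually.of_forall fun k => ?_)
        rw [lintegral_const_mul (f := fun x => ∫⁻ y in U, F k x y ∂ν) _
            (hF k).lintegral_prod_right',
          lintegral_lintegral_swap (hF k).aemeasurable]
        calc _ ≤ (b k)⁻¹ * ∫⁻ y in U, μ (ball x₀ (r k)) ∂ν := by
              gcongr with y
              exact hFμ k y
          _ = _ := by
              rw [setLIntegral_const, ENNReal.div_eq_inv_mul, mul_assoc]

/-- Two uniformly distributed probability measures on a separable metric space are equal. -/
theorem eq_of_uniform_of_isProbabilityMeasure {μ ν : Measure X} [IsProbabilityMeasure μ]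
    [IsProbabilityMeasure ν] (hμ : ∀ x y r, μ (ball x r) = μ (ball y r))
    (hν : ∀ x y r, ν (ball x r) = ν (ball y r)) : μ = ν := by
  obtain ⟨x₀⟩ : Nonempty X := nonempty_of_isProbabilityMeasure μ
  obtain ⟨r, -, hr0, hr⟩ := exists_seq_strictAnti_tendsto (0 : ℝ)
  set q := fun k => μ (ball x₀ (r k)) / ν (ball x₀ (r k))
  have hqi k : (q k)⁻¹ = ν (ball x₀ (r k)) / μ (ball x₀ (r k)) :=
    ENNReal.inv_div (.inl (measure_ne_top _ _))
      (.inl (measure_ball_ne_zero_of_uniform hν _ (hr0 k)))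
  have h1 : 1 ≤ liminf q atTop := by
    simpa using measure_isOpen_le_liminf hμ hν x₀ isOpen_univ hr0 hr
  have h2 : limsup q atTop ≤ 1 := by
    have := measure_isOpen_le_liminf hν hμ x₀ isOpen_univ hr0 hr
    simp only [measure_univ, mul_one, ← hqi] at this
    rw [← ENNReal.inv_limsup] at this
    simpa using this
  have hq : Tendsto q atTop (𝓝 1) :=
    tendsto_of_le_liminf_of_limsup_le h1 h2
  have hqi' : Tendsto (fun k => (q k)⁻¹) atTop (𝓝 1) := by
    simpa using tendsto_inv_iff.2 hq
  refine ext_of_generate_finite _ (BorelSpace.measurable_eq (α := X)) isPiSystem_isOpen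
    (fun U hU => le_antisymm ?_ ?_) (by simp)
  · have h3 := measure_isOpen_le_liminf hμ hν x₀ hU hr0 hr
    have h4 := (ENNReal.Tendsto.mul_const (b := ν U) hq (.inr (measure_ne_top _ _))).liminf_eq
    rw [one_mul] at h4
    exact h3.trans_eq h4
  · have h3 := measure_isOpen_le_liminf hν hμ x₀ hU hr0 hr
    have h4 := (ENNReal.Tendsto.mul_const (b := μ U) hqi' (.inr (measure_ne_top _ _))).liminf_eq
    simp only [hqi] at h4
    rw [one_mul] at h4
    exact h3.trans_eq h4

/-- Two finite uniformly distributed measures on a separable metric space are proportional. -/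
theorem exists_eq_smul_of_uniform {μ ν : Measure X} [IsFiniteMeasure μ]
    [IsFiniteMeasure ν] [NeZero ν] (hμ : ∀ x y r, μ (ball x r) = μ (ball y r))
    (hν : ∀ x y r, ν (ball x r) = ν (ball y r)) : ∃ c : ℝ≥0∞, c ≠ ⊤ ∧ μ = c • ν := by
  rcases eq_or_ne μ 0 with rfl | h0
  · exact ⟨0, by simp, by simp⟩
  have : NeZero μ := ⟨h0⟩
  have hν0 : ν univ ≠ 0 := by simpa using NeZero.ne ν
  have hμ0 : μ univ ≠ 0 := by simpa using h0
  have key := eq_of_uniform_of_isProbabilityMeasure (μ := (μ univ)⁻¹ • μ) (ν := (ν univ)⁻¹ • ν)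
    (fun x y r => by simp [hμ x y r]) (fun x y r => by simp [hν x y r])
  refine ⟨μ univ * (ν univ)⁻¹, ENNReal.mul_ne_top (measure_ne_top _ _)
    (ENNReal.inv_ne_top.2 hν0), ?_⟩
  rw [mul_smul, ← key, smul_smul, ENNReal.mul_inv_cancel hμ0 (measure_ne_top _ _), one_smul]

end UniformlyDistributed

section SphereMeasure

open Set Filter Topology Measure
open scoped Pointwise

lemma hausdorffMeasure_sphere_lt_top (n : ℕ) : μH[(n : ℝ)] (sphere (0 : E n) 1) < ⊤ := by
  set face : Fin (n + 1) → ℝ → (Fin n → ℝ) → E n := fun i ε y => WithLp.toLp 2 (i.insertNth ε y)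
  set chart : Fin (n + 1) → ℝ → (Fin n → ℝ) → E n := fun i ε y => ‖face i ε y‖⁻¹ • face i ε y
  have hface i ε : ContDiff ℝ 1 (face i ε) := by
    rw [contDiff_euclidean]
    intro j
    refine Fin.succAboveCases i ?_ (fun k => ?_) j
    · simpa [face] using contDiff_const
    · simpa [face] using contDiff_apply ℝ ℝ k
  have hchart i {ε : ℝ} (hε : ε ≠ 0) : ContDiff ℝ 1 (chart i ε) := by
    have hne y : face i ε y ≠ 0 := by
      intro h
      have := congrArg (fun z : E n => z i) h
      simp [face, hε] at this
    exact (((hface i ε).norm ℝ hne).inv fun y => norm_ne_zero_iff.2 (hne y)).smul (hface i ε)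
  have hfin i {ε : ℝ} (hε : ε ≠ 0) : μH[(n : ℝ)] (chart i ε '' Icc (-1) 1) < ⊤ := by
    obtain ⟨C, hC⟩ := (hchart i hε).locallyLipschitz.locallyLipschitzOn (s := Icc (-1) 1)
      |>.exists_lipschitzOnWith_of_compact isCompact_Icc
    refine (hC.hausdorffMeasure_image_le n.cast_nonneg).trans_lt ?_
    have : (μH[(n : ℝ)] : Measure (Fin n → ℝ)) = volume := by
      simpa using hausdorffMeasure_pi_real (ι := Fin n)
    rw [this]
    exact ENNReal.mul_lt_top (ENNReal.rpow_lt_top_of_nonneg n.cast_nonneg ENNReal.coe_ne_top)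
      isCompact_Icc.measure_lt_top
  have hcover : sphere (0 : E n) 1 ⊆
      ⋃ i, (chart i 1 '' Icc (-1) 1 ∪ chart i (-1) '' Icc (-1) 1) := by
    intro x hx
    have hx1 : ‖x‖ = 1 := by simpa using hx
    obtain ⟨i, hi⟩ := Finite.exists_max fun i => |x i|
    have hxi : 0 < |x i| := by
      refine (abs_nonneg _).lt_of_ne fun h => ?_
      have : x = 0 := by
        ext j
        simpa using (hi j).trans h.ge
      simp [this] at hx1
    have hy : (fun j => x (i.succAbove j) / |x i|) ∈ Icc (-1 : Fin n → ℝ) 1 := by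
      have h j : |x (i.succAbove j) / (|x i|)| ≤ 1 := by
        rw [abs_div, abs_abs]
        exact div_le_one_of_le₀ (hi _) hxi.le
      exact ⟨fun j => (abs_le.1 (h j)).1, fun j => (abs_le.1 (h j)).2⟩
    have hval {ε : ℝ} (hε : x i = |x i| * ε) :
        chart i ε (fun j => x (i.succAbove j) / |x i|) = x := by
      have hf : face i ε (fun j => x (i.succAbove j) / |x i|) = |x i|⁻¹ • x := by
        ext j
        refine Fin.succAboveCases i ?_ (fun k => ?_) j
        · simp only [face, Fin.insertNth_apply_same, PiLp.smul_apply, smul_eq_mul]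
          rw [eq_inv_mul_iff_mul_eq₀ hxi.ne', ← hε]
        · simp [face, div_eq_inv_mul]
      simp only [chart, hf, norm_smul, hx1, norm_inv, mul_one, inv_inv, smul_smul]
      rw [Real.norm_eq_abs, abs_abs, mul_inv_cancel₀ hxi.ne', one_smul]
    refine mem_iUnion.2 ⟨i, ?_⟩
    rcases le_total 0 (x i) with h | h
    · exact .inl ⟨_, hy, hval (by rw [abs_of_nonneg h, mul_one])⟩
    · exact .inr ⟨_, hy, hval (by rw [abs_of_nonpos h]; ring)⟩
  refine (measure_mono hcover).trans_lt ((measure_iUnion_fintype_le _ _).trans_lt ?_)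
  exact ENNReal.sum_lt_top.2 fun i _ => (measure_union_le _ _).trans_lt
    (ENNReal.add_lt_top.2 ⟨hfin i one_ne_zero, hfin i (by norm_num)⟩)

lemma exists_linearIsometryEquiv_apply_eq {n : ℕ} {x y : E n} (h : ‖x‖ = ‖y‖) :
    ∃ e : E n ≃ₗᵢ[ℝ] E n, e x = y :=
  ⟨_, Submodule.reflection_sub h⟩

lemma val_image_ball_sphere {n : ℕ} (x : sphere (0 : E n) 1) (r : ℝ) :
    (Subtype.val '' ball x r : Set (E n)) = ball (x : E n) r ∩ sphere 0 1 := by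
  ext y
  simp only [mem_image, Subtype.exists, exists_and_right, exists_eq_right, mem_inter_iff]
  exact ⟨fun ⟨h, h'⟩ => ⟨h', h⟩, fun ⟨h, h'⟩ => ⟨h', h⟩⟩

lemma linearIsometryEquiv_image_ball_inter_sphere {n : ℕ} (e : E n ≃ₗᵢ[ℝ] E n) (x : E n) (r : ℝ) :
    e '' (ball x r ∩ sphere 0 1) = ball (e x) r ∩ sphere 0 1 := by
  rw [image_inter e.injective, e.image_ball, e.image_sphere, map_zero]

/-- On the unit sphere, the Hausdorff measure is a finite multiple of `Measure.toSphere volume`. -/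
theorem exists_hausdorffMeasure_eq_smul_toSphere (n : ℕ) : ∃ c : ℝ≥0∞, c ≠ ⊤ ∧
    (μH[(n : ℝ)] : Measure (sphere (0 : E n) 1)) = c • (volume : Measure (E n)).toSphere := by
  have hval (s : Set (sphere (0 : E n) 1)) : μH[(n : ℝ)] (Subtype.val '' s) = μH[(n : ℝ)] s :=
    isometry_subtype_coe.hausdorffMeasure_image (.inl n.cast_nonneg) s
  have : IsFiniteMeasure (μH[(n : ℝ)] : Measure (sphere (0 : E n) 1)) := by
    refine ⟨?_⟩
    rw [← hval, image_univ, Subtype.range_coe]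
    exact hausdorffMeasure_sphere_lt_top n
  have : NeZero (volume : Measure (E n)).toSphere := ⟨toSphere_ne_zero _⟩
  refine exists_eq_smul_of_uniform (fun x y r => ?_) fun x y r => ?_
  · obtain ⟨e, he⟩ := exists_linearIsometryEquiv_apply_eq (x := (x : E n)) (y := y) (by simp)
    rw [← hval, ← hval, val_image_ball_sphere, val_image_ball_sphere, ← he,
      ← linearIsometryEquiv_image_ball_inter_sphere]
    exact (e.isometry.hausdorffMeasure_image (.inl n.cast_nonneg) _).symm
  · obtain ⟨e, he⟩ := exists_linearIsometryEquiv_apply_eq (x := (x : E n)) (y := y) (by simp)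
    rw [toSphere_apply' _ measurableSet_ball, toSphere_apply' _ measurableSet_ball,
      val_image_ball_sphere, val_image_ball_sphere, ← he,
      ← linearIsometryEquiv_image_ball_inter_sphere]
    have hsmul (A : Set (E n)) : Ioo (0 : ℝ) 1 • (e '' A) = e '' (Ioo (0 : ℝ) 1 • A) := by
      simp only [← image2_smul, image_image2, image2_image_right, map_smul]
    rw [hsmul, e.image_eq_preimage_symm, e.symm.measurePreserving.measure_preimage_emb
      e.symm.toHomeomorph.measurableEmbedding]

instance (n : ℕ) : IsFiniteMeasure (μH[(n : ℝ)] : Measure (sphere (0 : E n) 1)) := by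
  obtain ⟨c, hc, h⟩ := exists_hausdorffMeasure_eq_smul_toSphere n
  rw [h]
  exact smul_finite _ hc

lemma setIntegral_sphere_eq {n : ℕ} (f : E n → ℝ) :
    ∫ x in sphere (0 : E n) 1, f x ∂μH[(n : ℝ)] = ∫ x : sphere (0 : E n) 1, f x ∂μH[(n : ℝ)] := by
  have := isometry_subtype_coe.map_hausdorffMeasure (X := sphere (0 : E n) 1)
    (d := n) (.inl n.cast_nonneg)
  rw [Subtype.range_coe] at this
  rw [← this, (MeasurableEmbedding.subtype_coe isClosed_sphere.measurableSet).integral_map]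

end SphereMeasure

section Polar

open Set Filter Topology Measure

lemma integrable_volumeIoiPow_iff {m : ℕ} {g : ℝ → ℝ} :
    Integrable (fun r : Ioi (0 : ℝ) => g r) (volumeIoiPow m) ↔
      IntegrableOn (fun r => r ^ m * g r) (Ioi 0) := by
  rw [integrableOn_iff_comap_subtypeVal measurableSet_Ioi, Measure.volumeIoiPow,
    integrable_withDensity_iff_integrable_smul']
  · apply integrable_congr
    refine .of_forall ?_
    rintro ⟨x, hx : 0 < x⟩
    simp (disch := positivity) [ENNReal.toReal_ofReal]
  · fun_prop
  · simp

lemma integral_volumeIoiPow {m : ℕ} (g : ℝ → ℝ) :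
    ∫ r : Ioi (0 : ℝ), g r ∂volumeIoiPow m = ∫ r in Ioi 0, r ^ m * g r := by
  rw [← integral_subtype_comap measurableSet_Ioi fun r => r ^ m * g r, Measure.volumeIoiPow,
    integral_withDensity_eq_integral_toReal_smul]
  · apply integral_congr_ae
    refine .of_forall ?_
    rintro ⟨x, hx : 0 < x⟩
    simp (disch := positivity) [ENNReal.toReal_ofReal]
  · fun_prop
  · simp

lemma integrable_iff_polar {n : ℕ} {F : E n → ℝ} :
    Integrable F ↔ Integrable
      (fun p : sphere (0 : E n) 1 × Ioi (0 : ℝ) => F ((p.2 : ℝ) • (p.1 : E n)))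
      ((volume : Measure (E n)).toSphere.prod (volumeIoiPow n)) := by
  have h := (volume : Measure (E n)).measurePreserving_homeomorphUnitSphereProd
  have := h.integrable_comp_emb (Homeomorph.measurableEmbedding _)
    (g := fun p => F ((p.2 : ℝ) • (p.1 : E n)))
  simp only [finrank_euclideanSpace, Fintype.card_fin, Nat.add_sub_cancel] at this
  rw [← this]
  conv_lhs => rw [← restrict_compl_singleton (μ := (volume : Measure (E n))) 0]
  rw [← IntegrableOn, integrableOn_iff_comap_subtypeVal (by measurability)]
  apply integrable_congr
  refine .of_forall fun x => ?_
  have hx : ‖(x : E n)‖ ≠ 0 := norm_ne_zero_iff.mpr x.2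
  simp [smul_smul, hx]

lemma integral_eq_polar {n : ℕ} (F : E n → ℝ) :
    ∫ x, F x = ∫ p : sphere (0 : E n) 1 × Ioi (0 : ℝ), F ((p.2 : ℝ) • (p.1 : E n))
      ∂((volume : Measure (E n)).toSphere.prod (volumeIoiPow n)) := by
  have h := (volume : Measure (E n)).measurePreserving_homeomorphUnitSphereProd
  have := h.integral_comp (Homeomorph.measurableEmbedding _)
    (fun p => F ((p.2 : ℝ) • (p.1 : E n)))
  simp only [finrank_euclideanSpace, Fintype.card_fin, Nat.add_sub_cancel] at this
  rw [← this]
  conv_lhs => rw [← restrict_compl_singleton (μ := (volume : Measure (E n))) 0]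
  rw [← integral_subtype_comap (measurableSet_singleton _).compl]
  apply integral_congr_ae
  refine .of_forall fun x => ?_
  have hx : ‖(x : E n)‖ ≠ 0 := norm_ne_zero_iff.mpr x.2
  simp [smul_smul, hx]

lemma integrableOn_pow_mul_comp_mul {m : ℕ} {ρ : ℝ → ℝ} {h : ℝ} (hh : 0 < h)
    (hρ : IntegrableOn (fun r => r ^ m * ρ r) (Ioi 0)) :
    IntegrableOn (fun r => r ^ m * ρ (r * h)) (Ioi 0) := by
  have := (integrableOn_Ioi_comp_mul_right_iff (fun r => r ^ m * ρ r) 0 hh).2 (by simpa using hρ)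
  refine (this.const_mul ((h ^ m)⁻¹)).congr (.of_forall fun r => ?_)
  simp only [mul_pow]
  field_simp

lemma integral_pow_mul_comp_mul {m : ℕ} {ρ : ℝ → ℝ} {h : ℝ} (hh : 0 < h) :
    ∫ r in Ioi 0, r ^ m * ρ (r * h) = (∫ r in Ioi 0, r ^ m * ρ r) / h ^ (m + 1) := by
  have := integral_comp_mul_right_Ioi (fun r => r ^ m * ρ r) 0 hh
  simp only [mul_pow, zero_mul, smul_eq_mul] at this
  rw [← mul_right_inj' hh.ne', mul_inv_cancel_left₀ hh.ne'] at this
  rw [eq_div_iff (by positivity), ← this, mul_comm, pow_succ', mul_assoc, ← integral_const_mul]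
  congr 2 with r
  ring

variable {n : ℕ} {H P : E n → ℝ} {ρ : ℝ → ℝ} {k : ℕ}

lemma integrable_and_integral_homogeneous
    (hhom : ∀ (t : ℝ) (x : E n), 0 < t → H (t • x) = t * H x)
    (hH : ContinuousOn H {(0 : E n)}ᶜ) (hpos : ∀ x ∈ sphere (0 : E n) 1, 0 < H x)
    (hP : ContinuousOn P {(0 : E n)}ᶜ)
    (hPhom : ∀ (t : ℝ) (x : E n), 0 < t → P (t • x) = t ^ k * P x)
    (hρm : Measurable ρ) (hρ : IntegrableOn (fun r => r ^ (n + k) * ρ r) (Ioi 0)) :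
    Integrable (fun x => P x * ρ (H x)) ∧
    ∫ x, P x * ρ (H x) = (∫ r in Ioi 0, r ^ (n + k) * ρ r) *
      ∫ ω : sphere (0 : E n) 1, P ω / H ω ^ (n + k + 1) ∂(volume : Measure (E n)).toSphere := by
  have hsub : ∀ ω : sphere (0 : E n) 1, (ω : E n) ∈ ({0}ᶜ : Set (E n)) := fun ω =>
    ne_zero_of_mem_unit_sphere ω
  have hHs : Continuous fun ω : sphere (0 : E n) 1 => H ω :=
    hH.comp_continuous continuous_subtype_val hsub
  have hPs : Continuous fun ω : sphere (0 : E n) 1 => P ω :=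
    hP.comp_continuous continuous_subtype_val hsub
  have hprod : (fun p : sphere (0 : E n) 1 × Ioi (0 : ℝ) =>
      P ((p.2 : ℝ) • (p.1 : E n)) * ρ (H ((p.2 : ℝ) • (p.1 : E n)))) =
      fun p => P p.1 * ((p.2 : ℝ) ^ k * ρ ((p.2 : ℝ) * H p.1)) := by
    ext p
    rw [hPhom _ _ p.2.2, hhom _ _ p.2.2]
    ring
  have hHp : ∀ ω : sphere (0 : E n) 1, 0 < H ω := fun ω => hpos _ ω.2
  have hpow : ∀ h : ℝ, (fun r : ℝ => r ^ n * (r ^ k * ρ (r * h))) =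
      fun r => r ^ (n + k) * ρ (r * h) := by
    intro h; ext r; ring
  have hint1 (ω : sphere (0 : E n) 1) :
      Integrable (fun r : Ioi (0 : ℝ) => (r : ℝ) ^ k * ρ ((r : ℝ) * H ω)) (volumeIoiPow n) := by
    rw [integrable_volumeIoiPow_iff (g := fun r => r ^ k * ρ (r * H ω)), hpow]
    exact integrableOn_pow_mul_comp_mul (hHp ω) hρ
  have h_int : Integrable (fun p : sphere (0 : E n) 1 × Ioi (0 : ℝ) =>
      P p.1 * ((p.2 : ℝ) ^ k * ρ ((p.2 : ℝ) * H p.1)))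
      ((volume : Measure (E n)).toSphere.prod (volumeIoiPow n)) := by
    rw [integrable_prod_iff]
    · refine ⟨.of_forall fun ω => (hint1 ω).const_mul (P ω), ?_⟩
      have : ∀ ω : sphere (0 : E n) 1, ∫ r : Ioi (0 : ℝ),
          ‖P ω * ((r : ℝ) ^ k * ρ ((r : ℝ) * H ω))‖ ∂volumeIoiPow n =
          |P ω| * ((∫ r in Ioi 0, r ^ (n + k) * |ρ r|) / H ω ^ (n + k + 1)) := by
        intro ω
        rw [← integral_pow_mul_comp_mul (hHp ω) (ρ := fun r => |ρ r|)]
        simp only [norm_mul, Real.norm_eq_abs, integral_const_mul]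
        rw [integral_volumeIoiPow fun r => |r ^ k| * |ρ (r * H ω)|]
        congr 1
        refine setIntegral_congr_fun measurableSet_Ioi fun r hr => ?_
        have hr' : 0 < r := hr
        simp only [abs_pow, abs_of_pos hr']
        ring
      simp only [this]
      refine Continuous.integrable_of_hasCompactSupport ?_ (HasCompactSupport.of_compactSpace _)
      exact hPs.abs.mul (continuous_const.div (hHs.pow _) fun ω => (pow_pos (hHp ω) _).ne')
    · apply Measurable.aestronglyMeasurable
      have h1 : Measurable fun p : sphere (0 : E n) 1 × Ioi (0 : ℝ) => P p.1 :=
        hPs.measurable.comp measurable_fst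
      have h2 : Measurable fun p : sphere (0 : E n) 1 × Ioi (0 : ℝ) => H p.1 :=
        hHs.measurable.comp measurable_fst
      have h3 : Measurable fun p : sphere (0 : E n) 1 × Ioi (0 : ℝ) => (p.2 : ℝ) :=
        measurable_subtype_coe.comp measurable_snd
      exact h1.mul ((h3.pow_const k).mul (hρm.comp (h3.mul h2)))
  refine ⟨integrable_iff_polar.2 (by rwa [hprod]), ?_⟩
  rw [integral_eq_polar, hprod, integral_prod _ h_int, ← integral_const_mul]
  refine integral_congr_ae (.of_forall fun ω => ?_)
  simp only [integral_const_mul]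
  rw [integral_volumeIoiPow fun r => r ^ k * ρ (r * H ω), hpow, integral_pow_mul_comp_mul (hHp ω)]
  ring

end Polar

section SupportFunction

open Set Filter Topology

/-- Smooth, strictly convex, positive support functions, extended `1`-homogeneously. -/
structure IsSupportFunction {n : ℕ} (H : E n → ℝ) : Prop where
  hom : ∀ (t : ℝ) (x : E n), 0 < t → H (t • x) = t * H x
  smooth : ContDiffOn ℝ (⊤ : ℕ∞) H {(0 : E n)}ᶜ
  pos_sphere : ∀ x ∈ sphere (0 : E n) 1, 0 < H x
  convex : ∀ x ∈ sphere (0 : E n) 1, ∀ v : E n, ⟪v, x⟫ = 0 → v ≠ 0 → 0 < ⟪(hess H x) v, v⟫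

/-- The gradient of `H ^ 2 / 2`. -/
def dualityMap {n : ℕ} (H : E n → ℝ) (x : E n) : E n := H x • gradient H x

/-- The derivative of `dualityMap H` away from the origin. -/
def dualityDeriv {n : ℕ} (H : E n → ℝ) (x : E n) : E n →L[ℝ] E n :=
  H x • hess H x + proj (gradient H x)

/-- The Jacobian of `dualityMap H`. -/
def dualityJacobian {n : ℕ} (H : E n → ℝ) (x : E n) : ℝ := (dualityDeriv H x).det

lemma proj_apply {n : ℕ} (x y : E n) : proj x y = ⟪x, y⟫ • x := rfl

lemma LinearMap.IsSymmetric.det_pos {n : ℕ} {L : E n →ₗ[ℝ] E n} (hL : L.IsSymmetric)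
    (hpos : ∀ v, v ≠ 0 → 0 < ⟪L v, v⟫) : 0 < LinearMap.det L := by
  rw [hL.det_eq_prod_eigenvalues (n := n + 1) (by simp)]
  refine Finset.prod_pos fun i _ => ?_
  have hne : hL.eigenvectorBasis (by simp) i ≠ 0 := by
    intro h0
    have := (hL.eigenvectorBasis (n := n + 1) (by simp)).orthonormal.1 i
    rw [h0] at this
    simp at this
  have := hpos _ hne
  rw [hL.apply_eigenvectorBasis, inner_smul_left, real_inner_self_eq_norm_sq,
    OrthonormalBasis.norm_eq_one] at this
  simpa using this

lemma exists_eq_smul_add {n : ℕ} {x : E n} (hx : x ≠ 0) (v : E n) :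
    ∃ (c : ℝ) (w : E n), ⟪w, x⟫ = 0 ∧ v = c • x + w := by
  refine ⟨⟪v, x⟫ / ‖x‖ ^ 2, v - (⟪v, x⟫ / ‖x‖ ^ 2) • x, ?_, by simp⟩
  have hx' : ‖x‖ ≠ 0 := norm_ne_zero_iff.2 hx
  rw [inner_sub_left, inner_smul_left, real_inner_self_eq_norm_sq]
  simp [hx']

lemma dualityDeriv_inner {n : ℕ} (H : E n → ℝ) (x v w : E n) :
    ⟪dualityDeriv H x v, w⟫ = H x * ⟪hess H x v, w⟫ + ⟪gradient H x, v⟫ * ⟪gradient H x, w⟫ := by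
  simp [dualityDeriv, proj_apply, inner_add_left, inner_smul_left]

namespace IsSupportFunction

variable {n : ℕ} {H : E n → ℝ} (hs : IsSupportFunction H) {x : E n}
include hs

lemma pos (hx : x ≠ 0) : 0 < H x := by
  have hx' : 0 < ‖x‖ := norm_pos_iff.2 hx
  have h1 := hs.pos_sphere (‖x‖⁻¹ • x) (by simp [norm_smul, hx'.ne'])
  rw [hs.hom _ _ (inv_pos.2 hx')] at h1
  exact pos_of_mul_pos_right h1 (inv_pos.2 hx').le

lemma map_zero : H 0 = 0 := by
  have := hs.hom 2 0 two_pos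
  rw [smul_zero] at this
  linarith

lemma contDiffAt (hx : x ≠ 0) : ContDiffAt ℝ (⊤ : ℕ∞) H x :=
  hs.smooth.contDiffAt (isOpen_compl_singleton.mem_nhds hx)

lemma differentiableAt (hx : x ≠ 0) : DifferentiableAt ℝ H x :=
  (hs.contDiffAt hx).differentiableAt (by simp)

lemma contDiffAt_gradient (hx : x ≠ 0) : ContDiffAt ℝ (⊤ : ℕ∞) (gradient H) x := by
  have h1 : ContDiffAt ℝ (⊤ : ℕ∞) (fderiv ℝ H) x :=
    (hs.contDiffAt hx).fderiv_right (by simp)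
  exact (InnerProductSpace.toDual ℝ (E n)).symm.contDiff.contDiffAt.comp x h1

lemma hasFDerivAt_gradient (hx : x ≠ 0) : HasFDerivAt (gradient H) (hess H x) x :=
  ((hs.contDiffAt_gradient hx).differentiableAt (by simp)).hasFDerivAt

lemma contDiffAt_hess (hx : x ≠ 0) : ContDiffAt ℝ (⊤ : ℕ∞) (hess H) x :=
  (hs.contDiffAt_gradient hx).fderiv_right (by simp)

lemma gradient_smul {t : ℝ} (ht : 0 < t) : gradient H (t • x) = gradient H x := by
  rcases eq_or_ne x 0 with rfl | hx
  · simp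
  have h1 : fderiv ℝ (fun y => H (t • y)) x = t • fderiv ℝ H (t • x) := by
    simpa using fderiv_comp_smul (f := H) (x := x) t
  have h2 : (fun y => H (t • y)) = fun y => t • H y := by
    ext y; exact hs.hom t y ht
  rw [h2, fderiv_fun_const_smul (𝕜 := ℝ) (hs.differentiableAt hx)] at h1
  have h3 := smul_right_injective _ ht.ne' h1
  simp [gradient, h3]

lemma hess_smul {t : ℝ} (ht : 0 < t) : t • hess H (t • x) = hess H x := by
  have h1 : fderiv ℝ (fun y => gradient H (t • y)) x = t • fderiv ℝ (gradient H) (t • x) := by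
    simpa using fderiv_comp_smul (f := gradient H) (x := x) t
  simp only [hs.gradient_smul ht] at h1
  exact h1.symm

lemma inner_gradient_self (hx : x ≠ 0) : ⟪gradient H x, x⟫ = H x := by
  rw [inner_gradient_left]
  have h1 : HasDerivAt (fun t : ℝ => t • x) x 1 := by
    simpa using (hasDerivAt_id (1 : ℝ)).smul_const x
  have h2 : HasDerivAt (fun t : ℝ => H (t • x)) (fderiv ℝ H x x) 1 := by
    have : HasFDerivAt H (fderiv ℝ H x) ((1 : ℝ) • x) := by
      simpa using (hs.differentiableAt hx).hasFDerivAt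
    exact this.comp_hasDerivAt 1 h1
  have h3 : HasDerivAt (fun t : ℝ => H (t • x)) (H x) 1 := by
    have : HasDerivAt (fun t : ℝ => t * H x) (H x) 1 := by
      simpa using (hasDerivAt_id (1 : ℝ)).mul_const (H x)
    refine this.congr_of_eventuallyEq ?_
    filter_upwards [lt_mem_nhds one_pos] with t ht using hs.hom t x ht
  exact h2.unique h3

lemma hess_self (hx : x ≠ 0) : hess H x x = 0 := by
  have h1 : HasDerivAt (fun t : ℝ => t • x) x 1 := by
    simpa using (hasDerivAt_id (1 : ℝ)).smul_const x
  have h2 : HasDerivAt (fun t : ℝ => gradient H (t • x)) (hess H x x) 1 := by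
    have : HasFDerivAt (gradient H) (hess H x) ((1 : ℝ) • x) := by
      simpa using hs.hasFDerivAt_gradient hx
    exact this.comp_hasDerivAt 1 h1
  have h3 : HasDerivAt (fun t : ℝ => gradient H (t • x)) 0 1 := by
    refine (hasDerivAt_const (1 : ℝ) (gradient H x)).congr_of_eventuallyEq ?_
    filter_upwards [lt_mem_nhds one_pos] with t ht using hs.gradient_smul ht
  exact h2.unique h3

lemma hess_symm (hx : x ≠ 0) (u v : E n) : ⟪hess H x u, v⟫ = ⟪u, hess H x v⟫ := by
  have key (a : E n) : hess H x a =
      (InnerProductSpace.toDual ℝ (E n)).symm (fderiv ℝ (fderiv ℝ H) x a) := by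
    have h1 : DifferentiableAt ℝ (fderiv ℝ H) x :=
      ((hs.contDiffAt hx).fderiv_right (m := (⊤ : ℕ∞)) (by simp)).differentiableAt (by simp)
    have h2 :=
      ((InnerProductSpace.toDual ℝ (E n)).symm.toContinuousLinearEquiv.toContinuousLinearMap
      |>.hasFDerivAt (x := fderiv ℝ H x)).comp x h1.hasFDerivAt
    have h3 := (hs.hasFDerivAt_gradient hx).unique h2
    rw [h3]
    rfl
  have hsym := (hs.contDiffAt hx).isSymmSndFDerivAt (by
    rw [minSmoothness_of_isRCLikeNormedField]
    exact WithTop.coe_le_coe.2 (le_top : (2 : ℕ∞) ≤ ⊤))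
  rw [key, key, real_inner_comm _ u]
  simp only [InnerProductSpace.toDual_symm_apply]
  exact hsym.eq u v

lemma hess_inner_smul_add (hx : x ≠ 0) (c : ℝ) (w : E n) :
    ⟪hess H x (c • x + w), c • x + w⟫ = ⟪hess H x w, w⟫ := by
  rw [map_add, map_smul, hs.hess_self hx, smul_zero, zero_add, inner_add_right, inner_smul_right,
    hs.hess_symm hx, hs.hess_self hx]
  simp

lemma hess_pos (hx : x ≠ 0) {v : E n} (hv : ⟪v, x⟫ = 0) (hv0 : v ≠ 0) :
    0 < ⟪hess H x v, v⟫ := by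
  have hx' : 0 < ‖x‖ := norm_pos_iff.2 hx
  have h1 := hs.convex (‖x‖⁻¹ • x) (by simp [norm_smul, hx'.ne']) v
    (by simp [inner_smul_right, hv]) hv0
  have h2 := hs.hess_smul (x := x) (inv_pos.2 hx')
  rw [← h2]
  simp only [smul_apply, inner_smul_left]
  exact mul_pos (by simpa using hx') h1

lemma dualityDeriv_pos (hx : x ≠ 0) {v : E n} (hv : v ≠ 0) : 0 < ⟪dualityDeriv H x v, v⟫ := by
  rw [dualityDeriv_inner]
  obtain ⟨c, w, hw, rfl⟩ := exists_eq_smul_add hx v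
  rw [hs.hess_inner_smul_add hx]
  have hH := hs.pos hx
  rcases eq_or_ne w 0 with rfl | hw0
  · have hc : c ≠ 0 := by rintro rfl; simp at hv
    simp only [inner_zero_right, mul_zero, add_zero, inner_smul_right,
      hs.inner_gradient_self hx, zero_add]
    exact mul_self_pos.2 (mul_ne_zero hc hH.ne')
  · have := hs.hess_pos hx hw hw0
    nlinarith [mul_pos hH this, mul_self_nonneg ⟪gradient H x, c • x + w⟫]

lemma dualityDeriv_symm (hx : x ≠ 0) :
    (dualityDeriv H x : E n →L[ℝ] E n).toLinearMap.IsSymmetric := by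
  intro u v
  simp only [ContinuousLinearMap.coe_coe]
  rw [real_inner_comm _ u, dualityDeriv_inner, dualityDeriv_inner, hs.hess_symm hx,
    real_inner_comm]
  ring

lemma dualityJacobian_pos (hx : x ≠ 0) : 0 < dualityJacobian H x :=
  LinearMap.IsSymmetric.det_pos (hs.dualityDeriv_symm hx) fun _ hv => hs.dualityDeriv_pos hx hv

lemma sigmaDet_pos (hx : x ∈ sphere (0 : E n) 1) : 0 < sigmaDet H x := by
  have hx0 : x ≠ 0 := ne_zero_of_mem_unit_sphere ⟨x, hx⟩
  refine LinearMap.IsSymmetric.det_pos (fun u v => ?_) fun v hv => ?_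
  · simp only [ContinuousLinearMap.coe_coe, add_apply, proj_apply,
      inner_add_left, inner_add_right, inner_smul_left, inner_smul_right, hs.hess_symm hx0]
    rw [real_inner_comm u x]
    simp
    ring
  · simp only [ContinuousLinearMap.coe_coe, add_apply, proj_apply,
      inner_add_left, inner_smul_left]
    obtain ⟨c, w, hw, rfl⟩ := exists_eq_smul_add hx0 v
    rw [hs.hess_inner_smul_add hx0]
    rcases eq_or_ne w 0 with rfl | hw0
    · have hc : c ≠ 0 := by rintro rfl; simp at hv
      have hx1 : ‖x‖ = 1 := by simpa using hx
      simp [inner_smul_right, hx1]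
      positivity
    · have := hs.hess_pos hx0 hw hw0
      have h2 := mul_self_nonneg ⟪x, c • x + w⟫
      simp only [conj_trivial]
      linarith

lemma dualityMap_smul {t : ℝ} (ht : 0 < t) : dualityMap H (t • x) = t • dualityMap H x := by
  simp [dualityMap, hs.hom t x ht, hs.gradient_smul ht, smul_smul]

lemma dualityDeriv_smul {t : ℝ} (ht : 0 < t) : dualityDeriv H (t • x) = dualityDeriv H x := by
  rw [dualityDeriv, dualityDeriv, hs.hom t x ht, hs.gradient_smul ht, mul_comm, mul_smul,
    hs.hess_smul ht]

lemma hasFDerivAt_dualityMap (hx : x ≠ 0) : HasFDerivAt (dualityMap H) (dualityDeriv H x) x := by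
  have h := (hs.differentiableAt hx).hasFDerivAt.smul (hs.hasFDerivAt_gradient hx)
  refine h.congr_fderiv ?_
  ext1 v
  simp [dualityDeriv, proj_apply, inner_gradient_left]

lemma continuousOn_dualityDeriv : ContinuousOn (dualityDeriv H) {(0 : E n)}ᶜ := by
  intro x hx
  have h1 := (hs.contDiffAt hx).continuousAt
  have h2 := (hs.contDiffAt_gradient hx).continuousAt
  have h3 := (hs.contDiffAt_hess hx).continuousAt
  refine ContinuousAt.continuousWithinAt ((h1.smul h3).add ?_)
  have : Continuous fun p : E n => ContinuousLinearMap.smulRightL ℝ (E n) (E n) (innerSL ℝ p) p :=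
    ((ContinuousLinearMap.smulRightL ℝ (E n) (E n)).continuous.comp
      (innerSL ℝ).continuous).clm_apply continuous_id
  exact this.continuousAt.comp h2

lemma continuousOn_dualityJacobian : ContinuousOn (dualityJacobian H) {(0 : E n)}ᶜ :=
  ContinuousLinearMap.continuous_det.comp_continuousOn hs.continuousOn_dualityDeriv

lemma dualityJacobian_smul {t : ℝ} (ht : 0 < t) :
    dualityJacobian H (t • x) = dualityJacobian H x := by
  rw [dualityJacobian, hs.dualityDeriv_smul ht, dualityJacobian]

lemma dualityJacobian_eq (hx : x ∈ sphere (0 : E n) 1) :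
    dualityJacobian H x = H x ^ (n + 2) * sigmaDet H x := by
  have hx0 : x ≠ 0 := ne_zero_of_mem_unit_sphere ⟨x, hx⟩
  have hH := hs.pos hx0
  have hx1 : ‖x‖ = 1 := by simpa using hx
  set w := gradient H x with hw
  have hwx : ⟪w, x⟫ = H x := hs.inner_gradient_self hx0
  let φ (y : E n) : Module.Dual ℝ (E n) := (innerSL ℝ y).toLinearMap
  have hfac : (dualityDeriv H x).toLinearMap =
      (H x • LinearMap.transvection (φ x) ((H x)⁻¹ • w - x)) ∘ₗ
        (hess H x + proj x : E n →L[ℝ] E n).toLinearMap ∘ₗ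
          LinearMap.transvection (φ (w - x)) x := by
    ext1 y
    have hA : hess H x x = 0 := hs.hess_self hx0
    have hxA : ⟪x, hess H x y⟫ = 0 := by rw [← hs.hess_symm hx0, hA, inner_zero_left]
    have h1 : (hess H x + proj x) (y + ⟪w - x, y⟫ • x) = hess H x y + ⟪w, y⟫ • x := by
      simp only [add_apply, map_add, map_smul, hA, proj_apply, real_inner_self_eq_norm_sq, hx1,
        inner_sub_left]
      module
    simp only [ContinuousLinearMap.coe_coe, LinearMap.comp_apply, LinearMap.smul_apply,
      LinearMap.transvection.apply, φ, innerSL_apply_apply, h1]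
    simp only [inner_add_right, inner_smul_right, hxA, real_inner_self_eq_norm_sq, hx1,
      dualityDeriv, ← hw, add_apply, smul_apply, proj_apply]
    match_scalars <;> field_simp <;> ring
  rw [dualityJacobian, ContinuousLinearMap.det, hfac, LinearMap.det_comp, LinearMap.det_comp,
    LinearMap.det_smul, LinearMap.transvection.det, LinearMap.transvection.det]
  simp only [φ, ContinuousLinearMap.coe_coe, innerSL_apply_apply, inner_sub_right, inner_sub_left,
    inner_smul_right, real_inner_self_eq_norm_sq, hx1, hwx, real_inner_comm w x,
    finrank_euclideanSpace, Fintype.card_fin]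
  rw [sigmaDet]
  field_simp
  ring

end IsSupportFunction

end SupportFunction

section DualityMap

open Set Filter Topology

lemma exists_norm_le_of_homogeneous {n : ℕ} {F : Type*} [NormedAddCommGroup F] {f : E n → F}
    (hf : ContinuousOn f {(0 : E n)}ᶜ) (hhom : ∀ (t : ℝ) (x : E n), 0 < t → f (t • x) = f x) :
    ∃ C, 0 < C ∧ ∀ x, x ≠ 0 → ‖f x‖ ≤ C := by
  obtain ⟨C, hC⟩ := (isCompact_sphere (0 : E n) 1).exists_bound_of_continuousOn
    (hf.mono fun x hx => ne_zero_of_mem_unit_sphere ⟨x, hx⟩)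
  refine ⟨max C 1, by positivity, fun x hx => ?_⟩
  have hx' : 0 < ‖x‖ := norm_pos_iff.2 hx
  rw [← hhom ‖x‖⁻¹ x (inv_pos.2 hx')]
  exact (hC _ (by simp [norm_smul, hx'.ne'])).trans (le_max_left _ _)

namespace IsSupportFunction

variable {n : ℕ} {H : E n → ℝ} (hs : IsSupportFunction H) {x : E n}
include hs

lemma exists_norm_dualityDeriv_le : ∃ C, 0 < C ∧ ∀ x, x ≠ 0 → ‖dualityDeriv H x‖ ≤ C :=
  exists_norm_le_of_homogeneous hs.continuousOn_dualityDeriv fun _ _ ht => hs.dualityDeriv_smul ht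

lemma exists_norm_le_mul : ∃ C, 0 < C ∧ ∀ x, ‖x‖ ≤ C * H x := by
  obtain ⟨C, hC, h⟩ := exists_norm_le_of_homogeneous (f := fun x => ‖x‖ / H x)
    (continuous_norm.continuousOn.div hs.smooth.continuousOn fun x hx => (hs.pos hx).ne')
    (fun t x ht => by
      rw [hs.hom t x ht, norm_smul, Real.norm_of_nonneg ht.le, mul_div_mul_left _ _ ht.ne'])
  refine ⟨C, hC, fun x => ?_⟩
  rcases eq_or_ne x 0 with rfl | hx
  · simp [hs.map_zero]
  · have := (le_abs_self _).trans (h x hx)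
    rwa [div_le_iff₀ (hs.pos hx)] at this

lemma dualityMap_zero : dualityMap H 0 = 0 := by simp [dualityMap, hs.map_zero]

lemma dualityDeriv_self (hx : x ≠ 0) : dualityDeriv H x x = dualityMap H x := by
  simp [dualityDeriv, dualityMap, hs.hess_self hx, proj_apply, hs.inner_gradient_self hx]

lemma inner_dualityMap_self (x : E n) : ⟪dualityMap H x, x⟫ = H x ^ 2 := by
  rcases eq_or_ne x 0 with rfl | hx
  · simp [hs.map_zero]
  · simp [dualityMap, inner_smul_left, hs.inner_gradient_self hx, sq]

lemma norm_dualityMap_le {C : ℝ} (hC : ∀ x, x ≠ 0 → ‖dualityDeriv H x‖ ≤ C) (x : E n) :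
    ‖dualityMap H x‖ ≤ C * ‖x‖ := by
  rcases eq_or_ne x 0 with rfl | hx
  · simp [hs.dualityMap_zero]
  · rw [← hs.dualityDeriv_self hx]
    exact (dualityDeriv H x).le_of_opNorm_le (hC x hx) x

lemma norm_dualityMap_sub_le {C : ℝ} (hC : ∀ x, x ≠ 0 → ‖dualityDeriv H x‖ ≤ C) (x y : E n) :
    ‖dualityMap H y - dualityMap H x‖ ≤ C * ‖y - x‖ := by
  by_cases h0 : (0 : E n) ∈ segment ℝ x y
  · have h1 := dist_add_dist_of_mem_segment h0
    rw [dist_zero_right, dist_zero_left, dist_comm, dist_eq_norm] at h1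
    have h2 := hs.norm_dualityMap_le hC x
    have h3 := hs.norm_dualityMap_le hC y
    have h4 := norm_sub_le (dualityMap H y) (dualityMap H x)
    rw [← h1]
    linarith
  · refine (convex_segment x y).norm_image_sub_le_of_norm_hasFDerivWithin_le
      (f' := dualityDeriv H) (𝕜 := ℝ) (fun z hz => ?_) (fun z hz => hC z ?_)
      (left_mem_segment ℝ x y) (right_mem_segment ℝ x y)
    · exact (hs.hasFDerivAt_dualityMap (by rintro rfl; exact h0 hz)).hasFDerivWithinAt
    · rintro rfl; exact h0 hz

lemma continuous_dualityMap : Continuous (dualityMap H) := by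
  obtain ⟨C, hC0, hC⟩ := hs.exists_norm_dualityDeriv_le
  refine (LipschitzWith.of_dist_le_mul (K := C.toNNReal) fun x y => ?_).continuous
  rw [dist_eq_norm, dist_eq_norm, Real.coe_toNNReal C hC0.le]
  exact hs.norm_dualityMap_sub_le hC y x

lemma inner_dualityMap_sub_pos {x y : E n} (hxy : x ≠ y) :
    0 < ⟪dualityMap H y - dualityMap H x, y - x⟫ := by
  by_cases h0 : (0 : E n) ∈ segment ℝ x y
  · obtain ⟨a, b, ha, hb, hab, h0⟩ := h0
    have key : ∀ (x y : E n) (a b : ℝ), 0 ≤ a → 0 ≤ b → a + b = 1 → a • x + b • y = 0 →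
        ⟪dualityMap H y, x⟫ ≤ 0 := by
      intro x y a b ha hb hab h0
      rcases ha.eq_or_lt with rfl | ha
      · have hb1 : b = 1 := by linarith
        have : y = 0 := by simpa [hb1] using h0
        simp [this, hs.dualityMap_zero]
      · have h1 : a * ⟪dualityMap H y, x⟫ + b * ⟪dualityMap H y, y⟫ = 0 := by
          rw [← inner_smul_right, ← inner_smul_right, ← inner_add_right, h0, inner_zero_right]
        rw [hs.inner_dualityMap_self] at h1
        have h2 : 0 ≤ b * H y ^ 2 := by positivity
        exact nonpos_of_mul_nonpos_right (by linarith : a * ⟪dualityMap H y, x⟫ ≤ 0) ha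
    have h1 := key x y a b ha hb hab h0
    have h2 := key y x b a hb ha (by linarith) (by rw [add_comm, h0])
    simp only [inner_sub_left, inner_sub_right, hs.inner_dualityMap_self]
    have h3 : 0 < H x ^ 2 + H y ^ 2 := by
      rcases eq_or_ne x 0 with rfl | hx
      · have := hs.pos hxy.symm
        positivity
      · have := hs.pos hx
        positivity
    linarith
  · have hne (t : ℝ) (ht : t ∈ Icc (0 : ℝ) 1) : x + t • (y - x) ≠ 0 := by
      intro h
      apply h0
      rw [segment_eq_image']
      exact ⟨t, ht, h⟩
    have hd (t : ℝ) (ht : t ∈ Icc (0 : ℝ) 1) :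
        HasDerivAt (fun t : ℝ => ⟪dualityMap H (x + t • (y - x)), y - x⟫)
          ⟪dualityDeriv H (x + t • (y - x)) (y - x), y - x⟫ t := by
      have h1 : HasDerivAt (fun t : ℝ => x + t • (y - x)) (y - x) t := by
        simpa using ((hasDerivAt_id t).smul_const (y - x)).const_add x
      have h2 := (hs.hasFDerivAt_dualityMap (hne t ht)).comp_hasDerivAt t h1
      simpa using h2.inner ℝ (hasDerivAt_const t (y - x))
    obtain ⟨c, hc, h⟩ := exists_hasDerivAt_eq_slope
      (fun t : ℝ => ⟪dualityMap H (x + t • (y - x)), y - x⟫) _ one_pos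
      (fun t ht => (hd t ht).continuousAt.continuousWithinAt)
      (fun t ht => hd t (Ioo_subset_Icc_self ht))
    have hpos := hs.dualityDeriv_pos (hne c (Ioo_subset_Icc_self hc))
      (sub_ne_zero.2 hxy.symm)
    rw [h] at hpos
    simpa [← inner_sub_left] using hpos

lemma dualityMap_injective : Function.Injective (dualityMap H) := by
  intro x y h
  by_contra hxy
  have := hs.inner_dualityMap_sub_pos hxy
  simp [h] at this

lemma inner_dualityMap_sub_nonneg (x y : E n) :
    0 ≤ ⟪dualityMap H y - dualityMap H x, y - x⟫ := by
  rcases eq_or_ne x y with rfl | hxy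
  · simp
  · exact (hs.inner_dualityMap_sub_pos hxy).le

lemma hasFDerivAt_half_sq (x : E n) :
    HasFDerivAt (fun y => H y ^ 2 / 2) (innerSL ℝ (dualityMap H x)) x := by
  rcases eq_or_ne x 0 with rfl | hx
  · obtain ⟨C, hC0, hC⟩ := hs.exists_norm_dualityDeriv_le
    rw [hs.dualityMap_zero, _root_.map_zero]
    refine Asymptotics.IsBigO.hasFDerivAt (n := 2) ?_ one_lt_two
    refine Asymptotics.IsBigO.of_bound C (.of_forall fun y => ?_)
    rw [← hs.inner_dualityMap_self, sub_zero, norm_div, norm_pow, norm_norm]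
    have h1 := abs_real_inner_le_norm (dualityMap H y) y
    have h2 := hs.norm_dualityMap_le hC y
    have h3 : ‖dualityMap H y‖ * ‖y‖ ≤ C * ‖y‖ * ‖y‖ := by gcongr
    rw [Real.norm_eq_abs, Real.norm_ofNat]
    nlinarith [abs_nonneg ⟪dualityMap H y, y⟫]
  · have h := ((hs.differentiableAt hx).hasFDerivAt.pow 2).mul_const (2⁻¹ : ℝ)
    simp only [← div_eq_mul_inv] at h
    refine h.congr_fderiv ?_
    ext1 v
    simp [dualityMap, inner_gradient_left]
    ring

lemma continuous_half_sq : Continuous fun y => H y ^ 2 / 2 :=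
  continuous_iff_continuousAt.2 fun x => (hs.hasFDerivAt_half_sq x).continuousAt

lemma hasDerivAt_half_sq_line (x v : E n) (t : ℝ) :
    HasDerivAt (fun t : ℝ => H (x + t • v) ^ 2 / 2) ⟪dualityMap H (x + t • v), v⟫ t := by
  have h1 : HasDerivAt (fun t : ℝ => x + t • v) v t := by
    simpa using ((hasDerivAt_id t).smul_const v).const_add x
  exact (hs.hasFDerivAt_half_sq (x + t • v)).comp_hasDerivAt t h1

lemma inner_dualityMap_le (x y : E n) : ⟪dualityMap H x, y⟫ ≤ H x ^ 2 / 2 + H y ^ 2 / 2 := by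
  obtain ⟨c, hc, h⟩ := exists_hasDerivAt_eq_slope _ _ one_pos
    (fun t _ => (hs.hasDerivAt_half_sq_line x (y - x) t).continuousAt.continuousWithinAt)
    (fun t _ => hs.hasDerivAt_half_sq_line x (y - x) t)
  have h1 := hs.inner_dualityMap_sub_nonneg x (x + c • (y - x))
  rw [add_sub_cancel_left, inner_smul_right, inner_sub_left, h] at h1
  have h2 := (mul_nonneg_iff_of_pos_left hc.1).1 h1
  simp only [one_smul, add_sub_cancel, zero_smul, add_zero, sub_zero, div_one, inner_sub_right,
    hs.inner_dualityMap_self] at h2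
  linarith

lemma dualityMap_surjective : Function.Surjective (dualityMap H) := by
  intro y
  obtain ⟨C, hC, hCH⟩ := hs.exists_norm_le_mul
  have hcont : Continuous fun x => H x ^ 2 / 2 - ⟪y, x⟫ :=
    hs.continuous_half_sq.sub (continuous_const.inner continuous_id)
  obtain ⟨x, hx⟩ := hcont.exists_forall_le' (0 : E n) (by
    have : ∀ᶠ x : E n in cocompact (E n), 2 * C ^ 2 * ‖y‖ ≤ ‖x‖ :=
      tendsto_norm_cocompact_atTop.eventually_ge_atTop _
    filter_upwards [this] with x hx
    rw [hs.map_zero, inner_zero_right]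
    have h1 := real_inner_le_norm y x
    have h2 : ‖x‖ ^ 2 ≤ C ^ 2 * H x ^ 2 := by
      rw [← mul_pow]; exact pow_le_pow_left₀ (norm_nonneg x) (hCH x) 2
    have h3 : 2 * C ^ 2 * ‖y‖ * ‖x‖ ≤ ‖x‖ ^ 2 := by
      rw [sq ‖x‖]; gcongr
    have h4 : 0 ≤ C ^ 2 * (H x ^ 2 - 2 * (‖y‖ * ‖x‖)) := by linarith
    have h5 := (mul_nonneg_iff_of_pos_left (by positivity)).1 h4
    linarith)
  refine ⟨x, ?_⟩
  have hmin : IsLocalMin (fun x => H x ^ 2 / 2 - ⟪y, x⟫) x := .of_forall hx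
  have hd : HasFDerivAt (fun x => H x ^ 2 / 2 - ⟪y, x⟫)
      (innerSL ℝ (dualityMap H x) - innerSL ℝ y) x :=
    (hs.hasFDerivAt_half_sq x).sub (innerSL ℝ y).hasFDerivAt
  have h0 := hmin.hasFDerivAt_eq_zero hd
  rw [← map_sub] at h0
  have h1 := congrArg (fun L => L (dualityMap H x - y)) h0
  simp only [innerSL_apply_apply, zero_apply, inner_self_eq_zero] at h1
  exact sub_eq_zero.1 h1

lemma image_dualityMap : dualityMap H '' {0}ᶜ = {0}ᶜ := by
  rw [image_compl_eq ⟨hs.dualityMap_injective, hs.dualityMap_surjective⟩, image_singleton,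
    hs.dualityMap_zero]

lemma lintegral_eq_lintegral_dualityMap (f : E n → ℝ≥0∞) :
    ∫⁻ y, f y = ∫⁻ x, ENNReal.ofReal (dualityJacobian H x) * f (dualityMap H x) := by
  have h := lintegral_image_eq_lintegral_abs_det_fderiv_mul volume
    (measurableSet_singleton (0 : E n)).compl
    (fun x hx => (hs.hasFDerivAt_dualityMap hx).hasFDerivWithinAt) hs.dualityMap_injective.injOn f
  rw [hs.image_dualityMap, restrict_compl_singleton] at h
  rw [h]
  refine lintegral_congr_ae ?_
  have : ∀ᵐ x : E n, x ≠ 0 := by simp [ae_iff]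
  filter_upwards [this] with x hx
  rw [← dualityJacobian, abs_of_pos (hs.dualityJacobian_pos hx)]

lemma integral_eq_integral_dualityMap (f : E n → ℝ) :
    ∫ y, f y = ∫ x, dualityJacobian H x * f (dualityMap H x) := by
  have h := integral_image_eq_integral_abs_det_fderiv_smul volume
    (measurableSet_singleton (0 : E n)).compl
    (fun x hx => (hs.hasFDerivAt_dualityMap hx).hasFDerivWithinAt) hs.dualityMap_injective.injOn f
  rw [hs.image_dualityMap, restrict_compl_singleton] at h
  rw [h]
  refine integral_congr_ae ?_
  have : ∀ᵐ x : E n, x ≠ 0 := by simp [ae_iff]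
  filter_upwards [this] with x hx
  rw [← dualityJacobian, abs_of_pos (hs.dualityJacobian_pos hx), smul_eq_mul]

lemma dualityMap_mem_body_iff : dualityMap H x ∈ body H ↔ H x ≤ 1 := by
  constructor
  · intro h
    rcases eq_or_ne x 0 with rfl | hx
    · simp [hs.map_zero]
    have hx' : 0 < ‖x‖ := norm_pos_iff.2 hx
    have h1 := h (‖x‖⁻¹ • x) (by simp [norm_smul, hx'.ne'])
    rw [inner_smul_right, hs.inner_dualityMap_self, hs.hom _ _ (inv_pos.2 hx')] at h1
    have h2 := le_of_mul_le_mul_left h1 (inv_pos.2 hx')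
    have := hs.pos hx
    nlinarith
  · intro h y hy
    rcases eq_or_ne x 0 with rfl | hx
    · simpa [hs.dualityMap_zero] using (hs.pos_sphere y hy).le
    have hHx := hs.pos hx
    have hHy := hs.pos_sphere y hy
    have h1 := hs.inner_dualityMap_le x ((H x / H y) • y)
    rw [inner_smul_right, hs.hom _ _ (div_pos hHx hHy), div_mul_cancel₀ _ hHy.ne', add_halves,
      div_mul_eq_mul_div, div_le_iff₀ hHy, sq, mul_assoc] at h1
    have h2 := le_of_mul_le_mul_left h1 hHx
    nlinarith

lemma isCompact_body : IsCompact (body H) := by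
  have hc : IsClosed (body H) := by
    simp only [body, ofPred_forall]
    exact isClosed_iInter fun x => isClosed_iInter fun _ =>
      isClosed_le (continuous_id.inner continuous_const) continuous_const
  obtain ⟨C, hC⟩ := (isCompact_sphere (0 : E n) 1).exists_bound_of_continuousOn
    (hs.smooth.continuousOn.mono fun x hx => ne_zero_of_mem_unit_sphere ⟨x, hx⟩)
  refine (isCompact_closedBall (0 : E n) (max C 0)).of_isClosed_subset hc fun y hy => ?_
  rw [mem_closedBall_zero_iff]
  rcases eq_or_ne y 0 with rfl | hy0
  · simp
  have hy' : 0 < ‖y‖ := norm_pos_iff.2 hy0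
  have hmem : ‖y‖⁻¹ • y ∈ sphere (0 : E n) 1 := by simp [norm_smul, hy'.ne']
  have h1 := hy _ hmem
  rw [inner_smul_right, real_inner_self_eq_norm_sq, sq, inv_mul_cancel_left₀ hy'.ne'] at h1
  exact h1.trans ((le_abs_self _).trans ((hC _ hmem).trans (le_max_left _ _)))

end IsSupportFunction

end DualityMap

section SpectralInequality

open Set Filter Topology

lemma ofReal_integral_le_lintegral_ofReal {α : Type*} [MeasurableSpace α] {μ : Measure α}
    {f : α → ℝ} (hf : Integrable f μ) :
    ENNReal.ofReal (∫ x, f x ∂μ) ≤ ∫⁻ x, ENNReal.ofReal (f x) ∂μ := by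
  rw [integral_eq_lintegral_pos_part_sub_lintegral_neg_part hf]
  exact (ENNReal.ofReal_le_ofReal (sub_le_self _ ENNReal.toReal_nonneg)).trans
    ENNReal.ofReal_toReal_le

lemma cubic_le_exp (s : ℝ) : 1 + s + s ^ 2 / 2 + s ^ 3 / 6 ≤ Real.exp s := by
  have hd (t : ℝ) : HasDerivAt (fun t => (1 + t + t ^ 2 / 2 + t ^ 3 / 6) * Real.exp (-t))
      (-(t ^ 3 / 6) * Real.exp (-t)) t := by
    have h1 : HasDerivAt (fun t : ℝ => 1 + t + t ^ 2 / 2 + t ^ 3 / 6) (1 + t + t ^ 2 / 2) t := by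
      refine ((((hasDerivAt_id t).const_add 1).add ((hasDerivAt_pow 2 t).div_const 2)).add
        ((hasDerivAt_pow 3 t).div_const 6)).congr_deriv ?_
      simp
      ring
    have h2 : HasDerivAt (fun t : ℝ => Real.exp (-t)) (-Real.exp (-t)) t := by
      simpa using (hasDerivAt_neg t).exp
    refine (h1.mul h2).congr_deriv ?_
    ring
  have key : (1 + s + s ^ 2 / 2 + s ^ 3 / 6) * Real.exp (-s) ≤ 1 := by
    have hcont : Continuous fun t : ℝ => (1 + t + t ^ 2 / 2 + t ^ 3 / 6) * Real.exp (-t) := by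
      fun_prop
    rcases le_total 0 s with h | h
    · have : AntitoneOn (fun t : ℝ => (1 + t + t ^ 2 / 2 + t ^ 3 / 6) * Real.exp (-t)) (Ici 0) := by
        refine antitoneOn_of_deriv_nonpos (convex_Ici 0) hcont.continuousOn
          (fun t _ => (hd t).differentiableAt.differentiableWithinAt) fun t ht => ?_
        rw [interior_Ici] at ht
        have ht' : 0 < t := ht
        rw [(hd t).deriv, neg_mul]
        exact neg_nonpos.2 (by positivity)
      simpa using this self_mem_Ici h h
    · have : MonotoneOn (fun t : ℝ => (1 + t + t ^ 2 / 2 + t ^ 3 / 6) * Real.exp (-t)) (Iic 0) := by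
        refine monotoneOn_of_deriv_nonneg (convex_Iic 0) hcont.continuousOn
          (fun t _ => (hd t).differentiableAt.differentiableWithinAt) fun t ht => ?_
        rw [interior_Iic] at ht
        have ht' : t < 0 := ht
        have : t ^ 3 < 0 := by nlinarith [mul_pos_of_neg_of_neg ht' ht']
        rw [(hd t).deriv]
        exact mul_nonneg (by linarith) (Real.exp_pos _).le
      simpa using this h self_mem_Iic h
  rwa [Real.exp_neg, ← div_eq_mul_inv, div_le_one (Real.exp_pos s)] at key

/-- Radial moments of the standard Gaussian. -/
def gaussianMoment (m : ℕ) : ℝ := ∫ r in Ioi (0 : ℝ), r ^ m * Real.exp (-(r ^ 2 / 2))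

lemma integrableOn_gaussianMoment (m : ℕ) :
    IntegrableOn (fun r : ℝ => r ^ m * Real.exp (-(r ^ 2 / 2))) (Ioi 0) := by
  have := integrableOn_rpow_mul_exp_neg_mul_sq (b := 1 / 2) (by norm_num) (s := m)
    (by have := Nat.cast_nonneg (α := ℝ) m; linarith)
  refine this.congr (.of_forall fun r => ?_)
  simp only [Real.rpow_natCast]
  ring_nf

lemma gaussianMoment_eq (m : ℕ) : gaussianMoment m =
    (1 / 2 : ℝ) ^ (-((m : ℝ) + 1) / 2) * (1 / 2) * Real.Gamma (((m : ℝ) + 1) / 2) := by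
  rw [← integral_rpow_mul_exp_neg_mul_rpow two_pos
    (by have := Nat.cast_nonneg (α := ℝ) m; linarith) (by norm_num), gaussianMoment]
  refine setIntegral_congr_fun measurableSet_Ioi fun r hr => ?_
  simp only [Real.rpow_natCast, Real.rpow_two]
  ring_nf

lemma gaussianMoment_pos (m : ℕ) : 0 < gaussianMoment m := by
  rw [gaussianMoment_eq]
  have : 0 < Real.Gamma (((m : ℝ) + 1) / 2) := Real.Gamma_pos_of_pos (by positivity)
  positivity

lemma gaussianMoment_add_two (m : ℕ) : gaussianMoment (m + 2) = (m + 1) * gaussianMoment m := by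
  rw [gaussianMoment_eq, gaussianMoment_eq]
  have h1 : (((m + 2 : ℕ) : ℝ) + 1) / 2 = ((m : ℝ) + 1) / 2 + 1 := by push_cast; ring
  have h2 : -(((m + 2 : ℕ) : ℝ) + 1) / 2 = -((m : ℝ) + 1) / 2 - 1 := by push_cast; ring
  rw [h1, h2, Real.Gamma_add_one (by positivity), Real.rpow_sub_one (by norm_num)]
  ring

namespace IsSupportFunction

variable {n : ℕ} {H : E n → ℝ} (hs : IsSupportFunction H)
include hs

lemma gaussian_integral {P : E n → ℝ} {k : ℕ} (hP : ContinuousOn P {(0 : E n)}ᶜ)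
    (hPhom : ∀ (t : ℝ) (x : E n), 0 < t → P (t • x) = t ^ k * P x) :
    Integrable (fun x => P x * Real.exp (-(H x ^ 2 / 2))) ∧
    ∫ x, P x * Real.exp (-(H x ^ 2 / 2)) = gaussianMoment (n + k) *
      ∫ ω : sphere (0 : E n) 1, P ω / H ω ^ (n + k + 1) ∂(volume : Measure (E n)).toSphere :=
  integrable_and_integral_homogeneous hs.hom hs.smooth.continuousOn hs.pos_sphere hP hPhom
    (ρ := fun r => Real.exp (-(r ^ 2 / 2))) (by fun_prop) (integrableOn_gaussianMoment _)

lemma inner_dualityMap_pow_smul (e : E n) (k : ℕ) (t : ℝ) (x : E n) (ht : 0 < t) :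
    ⟪dualityMap H (t • x), e⟫ ^ k * dualityJacobian H (t • x) =
      t ^ k * (⟪dualityMap H x, e⟫ ^ k * dualityJacobian H x) := by
  rw [hs.dualityMap_smul ht, hs.dualityJacobian_smul ht, inner_smul_left]
  simp only [conj_trivial]
  ring

lemma continuousOn_inner_dualityMap_pow (e : E n) (k : ℕ) :
    ContinuousOn (fun x => ⟪dualityMap H x, e⟫ ^ k * dualityJacobian H x) {(0 : E n)}ᶜ :=
  ((hs.continuous_dualityMap.inner continuous_const).pow k).continuousOn.mul
    hs.continuousOn_dualityJacobian

lemma integral_inner_dualityMap_eq_zero (hc : ∫ y in body H, y = 0) (e : E n) :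
    ∫ x, ⟪dualityMap H x, e⟫ ^ 1 * dualityJacobian H x * Real.exp (-(H x ^ 2 / 2)) = 0 := by
  have hhom := hs.inner_dualityMap_pow_smul e 1
  have hcont := hs.continuousOn_inner_dualityMap_pow e 1
  have hset : MeasurableSet (body H) := hs.isCompact_body.measurableSet
  have h1 : ∫ y in body H, ⟪y, e⟫ = 0 := by
    have h_int : Integrable (fun y : E n => y) (volume.restrict (body H)) :=
      continuous_id.continuousOn.integrableOn_compact hs.isCompact_body
    have := integral_inner (𝕜 := ℝ) h_int e
    simp only [real_inner_comm _ e] at this ⊢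
    rw [this, hc, inner_zero_left]
  have hind : IntegrableOn (fun r => r ^ (n + 1) * (Iic (1 : ℝ)).indicator (fun _ => (1 : ℝ)) r)
      (Ioi 0) := by
    have : (fun r : ℝ => r ^ (n + 1) * (Iic (1 : ℝ)).indicator (fun _ => (1 : ℝ)) r) =
        (Iic (1 : ℝ)).indicator fun r => r ^ (n + 1) := by
      ext r; by_cases hr : r ∈ Iic (1 : ℝ) <;> simp [hr]
    rw [this, IntegrableOn, integrable_indicator_iff measurableSet_Iic, IntegrableOn,
      Measure.restrict_restrict measurableSet_Iic, Iic_inter_Ioi]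
    exact ((continuous_pow (n + 1)).continuousOn.integrableOn_compact
      (isCompact_Icc (a := (0 : ℝ)) (b := 1))).mono_set Ioc_subset_Icc_self
  obtain ⟨-, h2⟩ := integrable_and_integral_homogeneous hs.hom hs.smooth.continuousOn hs.pos_sphere
    hcont hhom (ρ := (Iic (1 : ℝ)).indicator fun _ => 1)
    (measurable_const.indicator measurableSet_Iic) hind
  have h3 : ∫ x, ⟪dualityMap H x, e⟫ ^ 1 * dualityJacobian H x *
      (Iic (1 : ℝ)).indicator (fun _ => 1) (H x) = 0 := by
    rw [← h1, ← integral_indicator hset,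
      hs.integral_eq_integral_dualityMap ((body H).indicator fun y => ⟪y, e⟫)]
    refine integral_congr_ae (.of_forall fun x => ?_)
    by_cases hx : H x ≤ 1
    · simp [hx, hs.dualityMap_mem_body_iff, mul_comm]
    · simp [hx, hs.dualityMap_mem_body_iff]
  have hmom :
      0 < ∫ r in Ioi (0 : ℝ), r ^ (n + 1) * (Iic (1 : ℝ)).indicator (fun _ => (1 : ℝ)) r := by
    have : ∀ r : ℝ, r ^ (n + 1) * (Iic (1 : ℝ)).indicator (fun _ => (1 : ℝ)) r =
        (Iic (1 : ℝ)).indicator (fun r => r ^ (n + 1)) r := by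
      intro r; by_cases hr : r ∈ Iic (1 : ℝ) <;> simp [hr]
    simp only [this]
    rw [integral_indicator measurableSet_Iic, Measure.restrict_restrict measurableSet_Iic,
      Iic_inter_Ioi, ← intervalIntegral.integral_of_le zero_le_one, integral_pow]
    simp
    positivity
  rw [h3] at h2
  rw [(hs.gaussian_integral hcont hhom).2]
  rcases mul_eq_zero.1 h2.symm with h | h
  · exact absurd h hmom.ne'
  · rw [h, mul_zero]

lemma measurable_of_comp_dualityMap {f : E n → ℝ≥0∞}
    (hf : Measurable fun x => f (dualityMap H x)) : Measurable f := by
  have hemb := hs.continuous_dualityMap.measurableEmbedding hs.dualityMap_injective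
  intro A hA
  have : f ⁻¹' A = dualityMap H '' ((fun x => f (dualityMap H x)) ⁻¹' A) := by
    rw [show (fun x => f (dualityMap H x)) = f ∘ dualityMap H from rfl, preimage_comp,
      image_preimage_eq _ hs.dualityMap_surjective]
  rw [this]
  exact hemb.measurableSet_image.2 (hf hA)

lemma exists_dualityMap_inverse : ∃ S : E n → E n, (∀ x, S (dualityMap H x) = x) ∧
    ∀ y, dualityMap H (S y) = y := by
  refine ⟨Function.surjInv hs.dualityMap_surjective,
    Function.leftInverse_surjInv ⟨hs.dualityMap_injective, hs.dualityMap_surjective⟩,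
    Function.rightInverse_surjInv _⟩

lemma prekopa_leindler_dualityMap (s : E n) :
    (∫⁻ x, ENNReal.ofReal (dualityJacobian H x) *
        ENNReal.ofReal (Real.exp (-(H x ^ 2 / 2) + ⟪dualityMap H x, s⟫))) *
      (∫⁻ x, ENNReal.ofReal (dualityJacobian H x) *
        ENNReal.ofReal (Real.exp (-(H x ^ 2 / 2) - ⟪dualityMap H x, s⟫))) ≤
      (∫⁻ x, ENNReal.ofReal (dualityJacobian H x) *
        ENNReal.ofReal (Real.exp (-(H x ^ 2) +
          (H (x + s) ^ 2 / 2 + H (x - s) ^ 2 / 2) / 2))) ^ 2 := by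
  obtain ⟨S, hST, hTS⟩ := hs.exists_dualityMap_inverse
  have hT := hs.continuous_dualityMap
  have hφ := hs.continuous_half_sq
  have hH2 : Continuous fun y => H y ^ 2 := by simpa using hφ.mul_const 2
  have hφp : Continuous fun x => H (x + s) ^ 2 / 2 := hφ.comp (continuous_id.add continuous_const)
  have hφm : Continuous fun x => H (x - s) ^ 2 / 2 := hφ.comp (continuous_id.sub continuous_const)
  have h := prekopa_leindler
    (f := fun y => ENNReal.ofReal (Real.exp (-(H (S y) ^ 2 / 2) + ⟪y, s⟫)))
    (g := fun y => ENNReal.ofReal (Real.exp (-(H (S y) ^ 2 / 2) - ⟪y, s⟫)))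
    (h := fun y => ENNReal.ofReal (Real.exp (-(H (S y) ^ 2) +
          (H (S y + s) ^ 2 / 2 + H (S y - s) ^ 2 / 2) / 2)))
    (hs.measurable_of_comp_dualityMap (by
      simp only [hST]
      exact (Real.continuous_exp.comp
        (hφ.neg.add (hT.inner continuous_const))).measurable.ennreal_ofReal))
    (hs.measurable_of_comp_dualityMap (by
      simp only [hST]
      exact (Real.continuous_exp.comp
        (hφ.neg.sub (hT.inner continuous_const))).measurable.ennreal_ofReal))
    (hs.measurable_of_comp_dualityMap (by
      simp only [hST]
      exact (Real.continuous_exp.comp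
        (hH2.neg.add ((hφp.add hφm).div_const 2))).measurable.ennreal_ofReal))
    (fun y₁ y₂ => by
      rw [← ENNReal.ofReal_mul (Real.exp_pos _).le, ← ENNReal.ofReal_pow (Real.exp_pos _).le,
        ← Real.exp_add, sq (Real.exp _), ← Real.exp_add]
      refine ENNReal.ofReal_le_ofReal (Real.exp_le_exp.2 ?_)
      set x := S ((1 / 2 : ℝ) • (y₁ + y₂)) with hx
      have h1 := hs.inner_dualityMap_le (S y₁) (x + s)
      have h2 := hs.inner_dualityMap_le (S y₂) (x - s)
      have h3 := hs.inner_dualityMap_self x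
      rw [hx, hTS, ← hx] at h3
      rw [hTS] at h1 h2
      rw [inner_add_right] at h1
      rw [inner_sub_right] at h2
      rw [inner_smul_left, inner_add_left] at h3
      simp only [conj_trivial] at h3
      linarith)
  rw [hs.lintegral_eq_lintegral_dualityMap
      fun y => ENNReal.ofReal (Real.exp (-(H (S y) ^ 2 / 2) + ⟪y, s⟫)),
    hs.lintegral_eq_lintegral_dualityMap
      fun y => ENNReal.ofReal (Real.exp (-(H (S y) ^ 2 / 2) - ⟪y, s⟫)),
    hs.lintegral_eq_lintegral_dualityMap fun y => ENNReal.ofReal (Real.exp (-(H (S y) ^ 2) +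
          (H (S y + s) ^ 2 / 2 + H (S y - s) ^ 2 / 2) / 2))] at h
  simpa only [hST] using h

end IsSupportFunction

end SpectralInequality

section SecondVariation

open Set Filter Topology

namespace IsSupportFunction

variable {n : ℕ} {H : E n → ℝ} (hs : IsSupportFunction H) {x : E n}
include hs

lemma second_difference_nonneg (x s : E n) :
    0 ≤ H (x + s) ^ 2 / 2 + H (x - s) ^ 2 / 2 - H x ^ 2 := by
  have h1 := hs.inner_dualityMap_le x (x + s)
  have h2 := hs.inner_dualityMap_le x (x - s)
  rw [inner_add_right, hs.inner_dualityMap_self] at h1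
  rw [inner_sub_right, hs.inner_dualityMap_self] at h2
  linarith

lemma second_difference_le {C : ℝ} (hC : ∀ x, x ≠ 0 → ‖dualityDeriv H x‖ ≤ C) (x s : E n) :
    H (x + s) ^ 2 / 2 + H (x - s) ^ 2 / 2 - H x ^ 2 ≤ 2 * C * ‖s‖ ^ 2 := by
  have h1 := hs.inner_dualityMap_le (x + s) x
  have h2 := hs.inner_dualityMap_le (x - s) x
  have h3 := hs.inner_dualityMap_self (x + s)
  have h4 := hs.inner_dualityMap_self (x - s)
  rw [inner_add_right] at h3
  rw [inner_sub_right] at h4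
  have h5 := hs.norm_dualityMap_sub_le hC (x - s) (x + s)
  have h6 := real_inner_le_norm (dualityMap H (x + s) - dualityMap H (x - s)) s
  rw [inner_sub_left] at h6
  have h7 : ‖x + s - (x - s)‖ = 2 * ‖s‖ := by
    rw [show x + s - (x - s) = (2 : ℝ) • s by module, norm_smul]
    simp
  rw [h7] at h5
  nlinarith [mul_le_mul_of_nonneg_right h5 (norm_nonneg s)]

lemma tendsto_second_difference (hx : x ≠ 0) (e : E n) :
    Tendsto (fun t : ℝ => (H (x + t • e) ^ 2 / 2 + H (x - t • e) ^ 2 / 2 - H x ^ 2) / t ^ 2)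
      (𝓝[≠] 0) (𝓝 ⟪dualityDeriv H x e, e⟫) := by
  have hd (t : ℝ) : HasDerivAt
      (fun t : ℝ => H (x + t • e) ^ 2 / 2 + H (x - t • e) ^ 2 / 2 - H x ^ 2)
      (⟪dualityMap H (x + t • e), e⟫ - ⟪dualityMap H (x - t • e), e⟫) t := by
    have h1 := hs.hasDerivAt_half_sq_line x e t
    have h2 := hs.hasDerivAt_half_sq_line x (-e) t
    simp only [smul_neg, ← sub_eq_add_neg, inner_neg_right] at h2
    simpa [sub_eq_add_neg] using (h1.add h2).sub_const (H x ^ 2)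
  have hline (s : ℝ) : HasDerivAt (fun t : ℝ => ⟪dualityMap H (x + t • s • e), e⟫)
      ⟪dualityDeriv H x (s • e), e⟫ 0 := by
    have h1 : HasDerivAt (fun t : ℝ => x + t • s • e) (s • e) 0 := by
      simpa using ((hasDerivAt_id (0 : ℝ)).smul_const (s • e)).const_add x
    have h2 : HasFDerivAt (dualityMap H) (dualityDeriv H x) (x + (0 : ℝ) • s • e) := by
      simpa using hs.hasFDerivAt_dualityMap hx
    have h3 := (h2.comp_hasDerivAt (0 : ℝ) h1).inner ℝ (hasDerivAt_const (0 : ℝ) e)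
    simpa using h3
  have hdd : HasDerivAt
      (fun t : ℝ => ⟪dualityMap H (x + t • e), e⟫ - ⟪dualityMap H (x - t • e), e⟫)
      (2 * ⟪dualityDeriv H x e, e⟫) 0 := by
    have := (hline 1).sub (hline (-1))
    simp only [one_smul, neg_smul, smul_neg, ← sub_eq_add_neg, map_neg, inner_neg_left] at this
    refine this.congr_deriv ?_
    ring
  refine HasDerivAt.lhopital_zero_nhdsNE (.of_forall hd)
    (.of_forall fun t => hasDerivAt_pow 2 t) ?_ ?_ ?_ ?_
  · filter_upwards [self_mem_nhdsWithin] with t ht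
    simpa using ht
  · have := (hd 0).continuousAt.tendsto.mono_left (nhdsWithin_le_nhds (s := {0}ᶜ))
    simpa using this
  · have : Tendsto (fun t : ℝ => t ^ 2) (𝓝 0) (𝓝 (0 ^ 2)) := (continuous_pow 2).tendsto 0
    simpa using this.mono_left (nhdsWithin_le_nhds (s := {0}ᶜ))
  · have := (hasDerivAt_iff_tendsto_slope_zero.1 hdd).const_mul (1 / 2)
    simp only [zero_add, zero_smul, add_zero, sub_zero, sub_self, smul_eq_mul] at this
    refine (this.congr' ?_).trans_eq (by ring_nf)
    filter_upwards [self_mem_nhdsWithin] with t ht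
    have : t ≠ 0 := ht
    push_cast
    field_simp

lemma tendsto_exp_second_difference (hx : x ≠ 0) (e : E n) :
    Tendsto (fun t : ℝ => (Real.exp ((H (x + t • e) ^ 2 / 2 + H (x - t • e) ^ 2 / 2 - H x ^ 2) / 2)
      - 1) / t ^ 2) (𝓝[≠] 0) (𝓝 (⟪dualityDeriv H x e, e⟫ / 2)) := by
  set δ := fun t : ℝ => H (x + t • e) ^ 2 / 2 + H (x - t • e) ^ 2 / 2 - H x ^ 2
  have h1 := (hs.tendsto_second_difference hx e).div_const 2
  have h2 : Tendsto (fun t => δ t / 2) (𝓝[≠] 0) (𝓝 0) := by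
    have hc : Continuous fun t => δ t / 2 := by
      have ha := hs.continuous_half_sq.comp (f := fun t : ℝ => x + t • e) (by fun_prop)
      have hb := hs.continuous_half_sq.comp (f := fun t : ℝ => x - t • e) (by fun_prop)
      exact ((ha.add hb).sub continuous_const).div_const 2
    have := (hc.tendsto 0).mono_left (nhdsWithin_le_nhds (s := {0}ᶜ))
    simpa [δ] using this
  have h3 : Tendsto (fun t => dslope Real.exp 0 (δ t / 2)) (𝓝[≠] 0) (𝓝 1) := by
    have : ContinuousAt (dslope Real.exp 0) 0 :=
      continuousAt_dslope_same.2 Real.differentiableAt_exp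
    have h4 := this.tendsto.comp h2
    simpa [dslope_same, Function.comp_def] using h4
  refine ((h1.mul h3).congr fun t => ?_).trans_eq (by ring_nf)
  have := sub_smul_dslope Real.exp 0 (δ t / 2)
  rw [sub_zero, Real.exp_zero, smul_eq_mul] at this
  rw [← this]
  ring

end IsSupportFunction

end SecondVariation

section SpectralGap

open Set Filter Topology

lemma le_of_eventually_mul_le_sq {A m q b : ℝ} (hA : 0 < A) {β : ℝ → ℝ}
    (hβ : Tendsto β (𝓝[≠] 0) (𝓝 (b / 2)))
    (h : ∀ᶠ t in 𝓝[≠] (0 : ℝ), 0 ≤ A + t ^ 2 / 2 * m + t ^ 3 / 6 * q →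
      (A + t ^ 2 / 2 * m + t ^ 3 / 6 * q) * (A + t ^ 2 / 2 * m - t ^ 3 / 6 * q) ≤
        (A + t ^ 2 * β t) ^ 2) : m ≤ b := by
  have ht : Tendsto (fun t : ℝ => t) (𝓝[≠] 0) (𝓝 0) := nhdsWithin_le_nhds
  have h1 : Tendsto (fun t : ℝ => A + t ^ 2 / 2 * m + t ^ 3 / 6 * q) (𝓝[≠] 0) (𝓝 A) := by
    have : Continuous fun t : ℝ => A + t ^ 2 / 2 * m + t ^ 3 / 6 * q := by fun_prop
    simpa [Function.comp_def] using (this.tendsto 0).comp ht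
  have h2 : Tendsto (fun t : ℝ => A * m + t ^ 2 * m ^ 2 / 4 - t ^ 4 * q ^ 2 / 36) (𝓝[≠] 0)
      (𝓝 (A * m)) := by
    have : Continuous fun t : ℝ => A * m + t ^ 2 * m ^ 2 / 4 - t ^ 4 * q ^ 2 / 36 := by fun_prop
    simpa [Function.comp_def] using (this.tendsto 0).comp ht
  have h3 : Tendsto (fun t : ℝ => 2 * A * β t + t ^ 2 * β t ^ 2) (𝓝[≠] 0) (𝓝 (A * b)) := by
    have := (hβ.const_mul (2 * A)).add ((ht.pow 2).mul (hβ.pow 2))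
    refine this.trans_eq ?_
    ring_nf
  refine le_of_mul_le_mul_left (le_of_tendsto_of_tendsto h2 h3 ?_) hA
  filter_upwards [h, h1.eventually (lt_mem_nhds hA), self_mem_nhdsWithin] with t h ht0 hne
  have hne : t ≠ 0 := hne
  have ht2 : 0 < t ^ 2 := by positivity
  refine le_of_mul_le_mul_left ?_ ht2
  have := h ht0.le
  nlinarith

namespace IsSupportFunction

variable {n : ℕ} {H : E n → ℝ} (hs : IsSupportFunction H)
include hs

lemma ae_dualityJacobian_pos : ∀ᵐ x : E n, 0 < dualityJacobian H x := by
  filter_upwards [compl_mem_ae_iff.2 (measure_singleton (0 : E n))] with x hx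
  exact hs.dualityJacobian_pos hx

lemma integrable_inner_dualityMap_pow (e : E n) (k : ℕ) : Integrable fun x =>
    ⟪dualityMap H x, e⟫ ^ k * dualityJacobian H x * Real.exp (-(H x ^ 2 / 2)) :=
  (hs.gaussian_integral (hs.continuousOn_inner_dualityMap_pow e k)
    (hs.inner_dualityMap_pow_smul e k)).1

lemma integrable_dualityJacobian : Integrable fun x =>
    dualityJacobian H x * Real.exp (-(H x ^ 2 / 2)) := by
  simpa using hs.integrable_inner_dualityMap_pow 0 0

lemma integral_dualityJacobian_pos :
    0 < ∫ x, dualityJacobian H x * Real.exp (-(H x ^ 2 / 2)) := by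
  have h : ∀ᵐ x : E n, 0 < dualityJacobian H x * Real.exp (-(H x ^ 2 / 2)) := by
    filter_upwards [hs.ae_dualityJacobian_pos] with x hx using mul_pos hx (Real.exp_pos _)
  refine lt_of_le_of_ne (integral_nonneg_of_ae (h.mono fun x hx => hx.le)) fun h0 => ?_
  have h1 := (integral_eq_zero_iff_of_nonneg_ae (h.mono fun x hx => hx.le)
    hs.integrable_dualityJacobian).1 h0.symm
  obtain ⟨x, hx, hx'⟩ := (h.and h1).exists
  exact hx.ne' hx'

lemma ofReal_moments_le_lintegral (hc : ∫ y in body H, y = 0) (e : E n) (t : ℝ) :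
    ENNReal.ofReal ((∫ x, dualityJacobian H x * Real.exp (-(H x ^ 2 / 2))) +
      t ^ 2 / 2 * (∫ x, ⟪dualityMap H x, e⟫ ^ 2 * dualityJacobian H x *
        Real.exp (-(H x ^ 2 / 2))) +
      t ^ 3 / 6 * ∫ x, ⟪dualityMap H x, e⟫ ^ 3 * dualityJacobian H x *
        Real.exp (-(H x ^ 2 / 2))) ≤
    ∫⁻ x, ENNReal.ofReal (dualityJacobian H x) *
        ENNReal.ofReal (Real.exp (-(H x ^ 2 / 2) + t * ⟪dualityMap H x, e⟫)) := by
  have i0 := hs.integrable_dualityJacobian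
  have i1 := (hs.integrable_inner_dualityMap_pow e 1).const_mul t
  have i2 := (hs.integrable_inner_dualityMap_pow e 2).const_mul (t ^ 2 / 2)
  have i3 := (hs.integrable_inner_dualityMap_pow e 3).const_mul (t ^ 3 / 6)
  have hsum : (∫ x, dualityJacobian H x * Real.exp (-(H x ^ 2 / 2))) +
      t ^ 2 / 2 * (∫ x, ⟪dualityMap H x, e⟫ ^ 2 * dualityJacobian H x *
        Real.exp (-(H x ^ 2 / 2))) +
      t ^ 3 / 6 * ∫ x, ⟪dualityMap H x, e⟫ ^ 3 * dualityJacobian H x *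
        Real.exp (-(H x ^ 2 / 2)) = ∫ x, (dualityJacobian H x * Real.exp (-(H x ^ 2 / 2)) +
        t * (⟪dualityMap H x, e⟫ ^ 1 * dualityJacobian H x * Real.exp (-(H x ^ 2 / 2))) +
        t ^ 2 / 2 * (⟪dualityMap H x, e⟫ ^ 2 * dualityJacobian H x *
          Real.exp (-(H x ^ 2 / 2))) +
        t ^ 3 / 6 * (⟪dualityMap H x, e⟫ ^ 3 * dualityJacobian H x *
          Real.exp (-(H x ^ 2 / 2)))) := by
    rw [integral_add ((i0.fun_add i1).fun_add i2) i3, integral_add (i0.fun_add i1) i2,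
      integral_add i0 i1, integral_const_mul, integral_const_mul, integral_const_mul,
      hs.integral_inner_dualityMap_eq_zero hc e, mul_zero, add_zero]
  rw [hsum]
  refine (ofReal_integral_le_lintegral_ofReal (((i0.fun_add i1).fun_add i2).fun_add i3)).trans
    (lintegral_mono_ae ?_)
  filter_upwards [hs.ae_dualityJacobian_pos] with x hx
  rw [← ENNReal.ofReal_mul hx.le, Real.exp_add]
  refine ENNReal.ofReal_le_ofReal ?_
  have h1 := mul_le_mul_of_nonneg_left (cubic_le_exp (t * ⟪dualityMap H x, e⟫))
    (mul_nonneg hx.le (Real.exp_pos (-(H x ^ 2 / 2))).le)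
  linarith

lemma norm_exp_second_difference_le {C : ℝ} (hC0 : 0 ≤ C)
    (hC : ∀ x, x ≠ 0 → ‖dualityDeriv H x‖ ≤ C) (x e : E n) {t : ℝ} (ht : t ≠ 0) (ht1 : |t| ≤ 1) :
    ‖(Real.exp ((H (x + t • e) ^ 2 / 2 + H (x - t • e) ^ 2 / 2 - H x ^ 2) / 2) - 1) / t ^ 2‖ ≤
      C * ‖e‖ ^ 2 * Real.exp (C * ‖e‖ ^ 2) := by
  have h0 := hs.second_difference_nonneg x (t • e)
  have h1 := hs.second_difference_le hC x (t • e)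
  set δ := H (x + t • e) ^ 2 / 2 + H (x - t • e) ^ 2 / 2 - H x ^ 2
  rw [norm_smul, mul_pow, Real.norm_eq_abs, sq_abs] at h1
  have ht2 : 0 < t ^ 2 := by positivity
  have ht3 : t ^ 2 ≤ 1 := by rwa [sq_le_one_iff_abs_le_one]
  have h2 : δ / 2 ≤ t ^ 2 * (C * ‖e‖ ^ 2) := by linarith
  have h3 : t ^ 2 * (C * ‖e‖ ^ 2) ≤ C * ‖e‖ ^ 2 := mul_le_of_le_one_left (by positivity) ht3
  have h4 : Real.exp (δ / 2) - 1 ≤ δ / 2 * Real.exp (δ / 2) := by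
    have h5 := Real.add_one_le_exp (-(δ / 2))
    have h6 : Real.exp (-(δ / 2)) * Real.exp (δ / 2) = 1 := by rw [← Real.exp_add]; simp
    nlinarith [Real.exp_pos (δ / 2)]
  have h5 : 0 ≤ Real.exp (δ / 2) - 1 := by
    rw [sub_nonneg, Real.one_le_exp_iff]
    linarith
  rw [Real.norm_of_nonneg (div_nonneg h5 ht2.le), div_le_iff₀ ht2]
  calc Real.exp (δ / 2) - 1 ≤ δ / 2 * Real.exp (δ / 2) := h4
    _ ≤ t ^ 2 * (C * ‖e‖ ^ 2) * Real.exp (C * ‖e‖ ^ 2) := by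
      gcongr
      linarith
    _ = C * ‖e‖ ^ 2 * Real.exp (C * ‖e‖ ^ 2) * t ^ 2 := by ring

lemma continuous_exp_second_difference (e : E n) (t : ℝ) : Continuous fun x =>
    (Real.exp ((H (x + t • e) ^ 2 / 2 + H (x - t • e) ^ 2 / 2 - H x ^ 2) / 2) - 1) / t ^ 2 := by
  have ha := hs.continuous_half_sq.comp (f := fun x : E n => x + t • e) (by fun_prop)
  have hb := hs.continuous_half_sq.comp (f := fun x : E n => x - t • e) (by fun_prop)
  have hc : Continuous fun y => H y ^ 2 := by simpa using hs.continuous_half_sq.mul_const 2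
  exact ((Real.continuous_exp.comp (((ha.add hb).sub hc).div_const 2)).sub
    continuous_const).div_const _

/-- A Brascamp-Lieb type inequality for the pushforward of the Gaussian-like density under the
duality map. -/
lemma integral_inner_dualityMap_sq_le (hc : ∫ y in body H, y = 0) (e : E n) :
    ∫ x, ⟪dualityMap H x, e⟫ ^ 2 * dualityJacobian H x * Real.exp (-(H x ^ 2 / 2)) ≤
      ∫ x, dualityJacobian H x * Real.exp (-(H x ^ 2 / 2)) * ⟪dualityDeriv H x e, e⟫ := by
  obtain ⟨C, hC0, hC⟩ := hs.exists_norm_dualityDeriv_le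
  have hw := hs.integrable_dualityJacobian
  set w := fun x => dualityJacobian H x * Real.exp (-(H x ^ 2 / 2)) with hw_def
  set q := fun (t : ℝ) (x : E n) =>
    (Real.exp ((H (x + t • e) ^ 2 / 2 + H (x - t • e) ^ 2 / 2 - H x ^ 2) / 2) - 1) / t ^ 2
    with hq_def
  have hball : ∀ᶠ t : ℝ in 𝓝[≠] 0, t ≠ 0 ∧ |t| ≤ 1 := by
    filter_upwards [self_mem_nhdsWithin,
      nhdsWithin_le_nhds (Metric.closedBall_mem_nhds (0 : ℝ) one_pos)] with t h1 h2
    exact ⟨h1, by simpa using h2⟩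
  have hβ : Tendsto (fun t => ∫ x, w x * q t x) (𝓝[≠] 0)
      (𝓝 (∫ x, w x * (⟪dualityDeriv H x e, e⟫ / 2))) := by
    refine tendsto_integral_filter_of_dominated_convergence
      (fun x => ‖w x‖ * (C * ‖e‖ ^ 2 * Real.exp (C * ‖e‖ ^ 2))) ?_ ?_ (hw.norm.mul_const _) ?_
    · exact .of_forall fun t => hw.aestronglyMeasurable.mul
        (hs.continuous_exp_second_difference e t).aestronglyMeasurable
    · filter_upwards [hball] with t ht
      refine .of_forall fun x => ?_
      rw [norm_mul]
      exact mul_le_mul_of_nonneg_left (hs.norm_exp_second_difference_le hC0.le hC x e ht.1 ht.2)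
        (norm_nonneg _)
    · filter_upwards [compl_mem_ae_iff.2 (measure_singleton (0 : E n))] with x hx
      exact (hs.tendsto_exp_second_difference hx e).const_mul _
  refine le_of_eventually_mul_le_sq (β := fun t => ∫ x, w x * q t x)
    (q := ∫ x, ⟪dualityMap H x, e⟫ ^ 3 * dualityJacobian H x * Real.exp (-(H x ^ 2 / 2)))
    hs.integral_dualityJacobian_pos (hβ.trans_eq ?_) ?_
  · rw [← integral_div]
    simp only [mul_div_assoc, hw_def]
  filter_upwards [hball] with t ht hpos
  have hqi : Integrable fun x => w x * q t x := by
    refine hw.mul_bdd (c := C * ‖e‖ ^ 2 * Real.exp (C * ‖e‖ ^ 2))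
      (hs.continuous_exp_second_difference e t).aestronglyMeasurable (.of_forall fun x => ?_)
    exact hs.norm_exp_second_difference_le hC0.le hC x e ht.1 ht.2
  have hpt (x : E n) : dualityJacobian H x * Real.exp (-(H x ^ 2) +
        (H (x + t • e) ^ 2 / 2 + H (x - t • e) ^ 2 / 2) / 2) =
      w x + t ^ 2 * (w x * q t x) := by
    have hq : t ^ 2 * q t x =
        Real.exp ((H (x + t • e) ^ 2 / 2 + H (x - t • e) ^ 2 / 2 - H x ^ 2) / 2) - 1 :=
      mul_div_cancel₀ _ (pow_ne_zero _ ht.1)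
    have h1 : -(H x ^ 2) + (H (x + t • e) ^ 2 / 2 + H (x - t • e) ^ 2 / 2) / 2 =
        -(H x ^ 2 / 2) + (H (x + t • e) ^ 2 / 2 + H (x - t • e) ^ 2 / 2 - H x ^ 2) / 2 := by
      ring
    rw [h1, Real.exp_add, mul_left_comm (t ^ 2), hq]
    simp only [hw_def]
    ring
  have hnn : ∀ᵐ x : E n, 0 ≤ w x + t ^ 2 * (w x * q t x) := by
    filter_upwards [hs.ae_dualityJacobian_pos] with x hx
    rw [← hpt]
    exact mul_nonneg hx.le (Real.exp_pos _).le
  have hsum : (∫ x, w x) + t ^ 2 * ∫ x, w x * q t x = ∫ x, (w x + t ^ 2 * (w x * q t x)) := by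
    rw [integral_add hw (hqi.const_mul _), integral_const_mul]
  have hB : (∫⁻ x, ENNReal.ofReal (dualityJacobian H x) *
        ENNReal.ofReal (Real.exp (-(H x ^ 2) +
          (H (x + t • e) ^ 2 / 2 + H (x - t • e) ^ 2 / 2) / 2))) =
      ENNReal.ofReal ((∫ x, w x) + t ^ 2 * ∫ x, w x * q t x) := by
    rw [hsum, ofReal_integral_eq_lintegral_ofReal (hw.fun_add (hqi.const_mul _)) hnn]
    refine lintegral_congr_ae ?_
    filter_upwards [hs.ae_dualityJacobian_pos] with x hx
    rw [← hpt, ENNReal.ofReal_mul hx.le]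
  have hBnn : 0 ≤ (∫ x, w x) + t ^ 2 * ∫ x, w x * q t x := by
    rw [hsum]
    exact integral_nonneg_of_ae hnn
  have hPL := hs.prekopa_leindler_dualityMap (t • e)
  have hp := hs.ofReal_moments_le_lintegral hc e t
  have hm := hs.ofReal_moments_le_lintegral hc e (-t)
  simp only [neg_mul, ← sub_eq_add_neg] at hm
  rw [hB] at hPL
  simp only [inner_smul_right] at hPL
  have h1 := (mul_le_mul' hp hm).trans hPL
  rw [← ENNReal.ofReal_mul hpos, ← ENNReal.ofReal_pow hBnn,
    ENNReal.ofReal_le_ofReal_iff (by positivity)] at h1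
  refine le_trans (le_of_eq ?_) h1
  ring

end IsSupportFunction

end SpectralGap

section SphereInequality

open Set Filter Topology

lemma integrable_sphere_of_continuousOn {n : ℕ} {f : E n → ℝ} (hf : ContinuousOn f {(0 : E n)}ᶜ)
    (μ : Measure (sphere (0 : E n) 1)) [IsFiniteMeasure μ] :
    Integrable (fun ω : sphere (0 : E n) 1 => f ω) μ := by
  have hc : Continuous fun ω : sphere (0 : E n) 1 => f ω :=
    hf.comp_continuous continuous_subtype_val fun ω => ne_zero_of_mem_unit_sphere ω
  exact hc.integrable_of_hasCompactSupport (HasCompactSupport.of_compactSpace _)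

lemma contDiff_det {n : ℕ} {m : WithTop ℕ∞} :
    ContDiff ℝ m fun L : E n →L[ℝ] E n => LinearMap.det L.toLinearMap := by
  have h (L : E n →L[ℝ] E n) : LinearMap.det L.toLinearMap =
      (Matrix.of fun i j => L (EuclideanSpace.single j 1) i).det := by
    rw [← LinearMap.det_toMatrix (EuclideanSpace.basisFun (Fin (n + 1)) ℝ).toBasis]
    congr 1
  simp only [h, Matrix.det_apply, Matrix.of_apply]
  refine ContDiff.sum fun σ _ => ContDiff.const_smul _ (contDiff_prod fun i _ => ?_)
  have h1 : ContDiff ℝ m fun L : E n →L[ℝ] E n => L (EuclideanSpace.single i 1) :=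
    contDiff_id.clm_apply contDiff_const
  exact contDiff_euclidean.1 h1 (σ i)

lemma contDiff_proj {n : ℕ} {m : WithTop ℕ∞} : ContDiff ℝ m (proj : E n → E n →L[ℝ] E n) :=
  ContDiff.smulRight (innerSL ℝ).contDiff contDiff_id

namespace IsSupportFunction

variable {n : ℕ} {H : E n → ℝ} (hs : IsSupportFunction H) {x : E n}
include hs

lemma contDiffAt_sigmaDet (hx : x ≠ 0) : ContDiffAt ℝ (⊤ : ℕ∞) (sigmaDet H) x :=
  contDiff_det.contDiffAt.comp x ((hs.contDiffAt_hess hx).add contDiff_proj.contDiffAt)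

lemma continuousOn_gradient : ContinuousOn (gradient H) {(0 : E n)}ᶜ := fun _ hx =>
  (hs.contDiffAt_gradient hx).continuousAt.continuousWithinAt

lemma continuousOn_hess : ContinuousOn (hess H) {(0 : E n)}ᶜ := fun _ hx =>
  (hs.contDiffAt_hess hx).continuousAt.continuousWithinAt

lemma continuousOn_sigmaDet : ContinuousOn (sigmaDet H) {(0 : E n)}ᶜ := fun _ hx =>
  (hs.contDiffAt_sigmaDet hx).continuousAt.continuousWithinAt

lemma continuousOn_hess_inner (e : E n) :
    ContinuousOn (fun x => ⟪hess H x e, e⟫) {(0 : E n)}ᶜ :=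
  (hs.continuousOn_hess.clm_apply continuousOn_const).inner continuousOn_const

lemma continuousOn_gradient_inner (e : E n) :
    ContinuousOn (fun x => ⟪gradient H x, e⟫) {(0 : E n)}ᶜ :=
  hs.continuousOn_gradient.inner continuousOn_const

lemma integral_sphere_inner_sq_le (hc : ∫ y in body H, y = 0) (e : E n) :
    ∫ ω : sphere (0 : E n) 1, ((n : ℝ) * ⟪gradient H ω, e⟫ ^ 2 - H ω * ⟪hess H ω e, e⟫) *
      (H ω * sigmaDet H ω) ∂(volume : Measure (E n)).toSphere ≤ 0 := by
  set μ := (volume : Measure (E n)).toSphere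
  have hDc : ContinuousOn (fun x => dualityJacobian H x * ⟪dualityDeriv H x e, e⟫)
      {(0 : E n)}ᶜ := hs.continuousOn_dualityJacobian.mul
    ((hs.continuousOn_dualityDeriv.clm_apply continuousOn_const).inner continuousOn_const)
  have h1 := hs.integral_inner_dualityMap_sq_le hc e
  have h2 := (hs.gaussian_integral (P := fun x => dualityJacobian H x * ⟪dualityDeriv H x e, e⟫)
    (k := 0) hDc fun t x ht => by
      rw [hs.dualityJacobian_smul ht, hs.dualityDeriv_smul ht, pow_zero, one_mul]).2
  simp only [mul_right_comm _ _ (Real.exp _)] at h2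
  rw [(hs.gaussian_integral (hs.continuousOn_inner_dualityMap_pow e 2)
    (hs.inner_dualityMap_pow_smul e 2)).2, h2, gaussianMoment_add_two, add_zero,
    mul_comm _ (gaussianMoment n), mul_assoc] at h1
  replace h1 := le_of_mul_le_mul_left h1 (gaussianMoment_pos n)
  have hHσ : ContinuousOn (fun x => H x * sigmaDet H x) {(0 : E n)}ᶜ :=
    hs.smooth.continuousOn.mul hs.continuousOn_sigmaDet
  have e1 : ∫ ω : sphere (0 : E n) 1, ⟪dualityMap H ω, e⟫ ^ 2 * dualityJacobian H ω /
      H ω ^ (n + 2 + 1) ∂μ =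
      ∫ ω : sphere (0 : E n) 1, ⟪gradient H ω, e⟫ ^ 2 * (H ω * sigmaDet H ω) ∂μ := by
    refine integral_congr_ae (.of_forall fun ω => ?_)
    have hH := hs.pos_sphere ω ω.2
    simp only [hs.dualityJacobian_eq ω.2, dualityMap, inner_smul_left, conj_trivial]
    field_simp
    ring
  have e2 : ∫ ω : sphere (0 : E n) 1, dualityJacobian H ω * ⟪dualityDeriv H ω e, e⟫ /
      H ω ^ (n + 1) ∂μ = ∫ ω : sphere (0 : E n) 1,
        (H ω * ⟪hess H ω e, e⟫ + ⟪gradient H ω, e⟫ ^ 2) * (H ω * sigmaDet H ω) ∂μ := by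
    refine integral_congr_ae (.of_forall fun ω => ?_)
    have hH := hs.pos_sphere ω ω.2
    simp only [hs.dualityJacobian_eq ω.2, dualityDeriv_inner]
    field_simp
    ring
  rw [e1, e2] at h1
  have hg := hs.continuousOn_gradient_inner e
  have hh := hs.continuousOn_hess_inner e
  have i1 := integrable_sphere_of_continuousOn ((hg.fun_pow 2).fun_mul hHσ) μ
  have i2 := integrable_sphere_of_continuousOn
    (((hs.smooth.continuousOn.fun_mul hh).fun_add (hg.fun_pow 2)).fun_mul hHσ) μ
  rw [← integral_const_mul] at h1
  refine le_trans (le_of_eq ?_) (sub_nonpos.2 h1)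
  rw [← integral_sub (i1.const_mul _) i2]
  refine integral_congr_ae (.of_forall fun ω => ?_)
  simp only
  ring

lemma integral_toSphere_nonpos (hc : ∫ y in body H, y = 0) :
    ∫ ω : sphere (0 : E n) 1, ((n : ℝ) * ‖gradient H ω‖ ^ 2 -
      H ω * LinearMap.trace ℝ (E n) (hess H ω).toLinearMap) *
      (H ω * sigmaDet H ω) ∂(volume : Measure (E n)).toSphere ≤ 0 := by
  set b := EuclideanSpace.basisFun (Fin (n + 1)) ℝ
  have hHσ : ContinuousOn (fun x => H x * sigmaDet H x) {(0 : E n)}ᶜ :=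
    hs.smooth.continuousOn.mul hs.continuousOn_sigmaDet
  have hpt (ω : sphere (0 : E n) 1) : ((n : ℝ) * ‖gradient H ω‖ ^ 2 -
      H ω * LinearMap.trace ℝ (E n) (hess H ω).toLinearMap) * (H ω * sigmaDet H ω) =
      ∑ i, ((n : ℝ) * ⟪gradient H ω, b i⟫ ^ 2 - H ω * ⟪hess H ω (b i), b i⟫) *
        (H ω * sigmaDet H ω) := by
    rw [← Finset.sum_mul, Finset.sum_sub_distrib, ← Finset.mul_sum, ← Finset.mul_sum,
      b.sum_sq_inner_left, LinearMap.trace_eq_sum_inner _ b]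
    simp only [real_inner_comm, ContinuousLinearMap.coe_coe]
  simp only [hpt]
  rw [integral_finsetSum _ fun i _ => integrable_sphere_of_continuousOn
    ((continuousOn_const.fun_mul ((hs.continuousOn_gradient_inner (b i)).fun_pow 2) |>.fun_sub
      (hs.smooth.continuousOn.fun_mul (hs.continuousOn_hess_inner (b i)))).fun_mul hHσ) _]
  exact Finset.sum_nonpos fun i _ => hs.integral_sphere_inner_sq_le hc (b i)

lemma inner_gradient_self_sphere (hx : x ∈ sphere (0 : E n) 1) : ⟪gradient H x, x⟫ = H x :=
  hs.inner_gradient_self (ne_zero_of_mem_unit_sphere ⟨x, hx⟩)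

lemma norm_tgrad_sq (hx : x ∈ sphere (0 : E n) 1) :
    ‖tgrad H x‖ ^ 2 = ‖gradient H x‖ ^ 2 - H x ^ 2 := by
  have hx1 : ‖x‖ = 1 := by simpa using hx
  rw [tgrad, norm_sub_sq_real, inner_smul_right, hs.inner_gradient_self_sphere hx, norm_smul, hx1,
    mul_one, Real.norm_eq_abs, sq_abs]
  ring

lemma setIntegral_sphere_nonpos (hc : ∫ y in body H, y = 0) :
    ∫ x in sphere (0 : E n) 1, ((n : ℝ) * ‖tgrad H x‖ ^ 2 -
      H x * (LinearMap.trace ℝ (E n) (hess H x).toLinearMap - (n : ℝ) * H x)) *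
        (H x * sigmaDet H x) ∂μH[(n : ℝ)] ≤ 0 := by
  obtain ⟨c, -, hμ⟩ := exists_hausdorffMeasure_eq_smul_toSphere n
  rw [setIntegral_sphere_eq, hμ, integral_smul_measure]
  refine smul_nonpos_of_nonneg_of_nonpos ENNReal.toReal_nonneg
    (le_trans (le_of_eq ?_) (hs.integral_toSphere_nonpos hc))
  refine integral_congr_ae (.of_forall fun ω => ?_)
  simp only [hs.norm_tgrad_sq ω.2]
  ring

end IsSupportFunction

end SphereInequality

section Rotations

open Set Filter Topology

/-- The infinitesimal rotation in the plane spanned by `a` and `b`. -/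
def planeRotationGen {n : ℕ} (a b : E n) : E n →L[ℝ] E n :=
  (innerSL ℝ a).smulRight b - (innerSL ℝ b).smulRight a

lemma planeRotationGen_apply {n : ℕ} (a b x : E n) :
    planeRotationGen a b x = ⟪a, x⟫ • b - ⟪b, x⟫ • a := rfl

/-- The rotation by the angle `t` in the plane spanned by the orthonormal vectors `a` and `b`. -/
def planeRotation {n : ℕ} (a b : E n) (ha : ‖a‖ = 1) (hb : ‖b‖ = 1) (hab : ⟪a, b⟫ = 0) (t : ℝ) :
    E n ≃ₗᵢ[ℝ] E n :=
  LinearIsometry.toLinearIsometryEquiv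
    { toLinearMap := LinearMap.id +
        (Real.cos t - 1) • ((innerSL ℝ a).smulRight a + (innerSL ℝ b).smulRight b).toLinearMap +
        Real.sin t • (planeRotationGen a b).toLinearMap
      norm_map' := fun x => by
        rw [← sq_eq_sq₀ (norm_nonneg _) (norm_nonneg _), ← real_inner_self_eq_norm_sq,
          ← real_inner_self_eq_norm_sq]
        have haa : ⟪a, a⟫ = 1 := by rw [real_inner_self_eq_norm_sq, ha, one_pow]
        have hbb : ⟪b, b⟫ = 1 := by rw [real_inner_self_eq_norm_sq, hb, one_pow]
        simp only [planeRotationGen, LinearMap.add_apply, LinearMap.smul_apply,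
          LinearMap.id_apply, ContinuousLinearMap.coe_coe, add_apply, sub_apply,
          ContinuousLinearMap.smulRight_apply, innerSL_apply_apply, inner_add_left,
          inner_add_right, inner_sub_left, inner_sub_right, inner_smul_left, inner_smul_right,
          real_inner_comm a x, real_inner_comm b x, haa, hbb, hab, real_inner_comm a b,
          conj_trivial]
        linear_combination (⟪a, x⟫ ^ 2 + ⟪b, x⟫ ^ 2) * Real.sin_sq_add_cos_sq t }
    rfl

lemma planeRotation_apply {n : ℕ} {a b : E n} (ha : ‖a‖ = 1) (hb : ‖b‖ = 1) (hab : ⟪a, b⟫ = 0)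
    (t : ℝ) (x : E n) : planeRotation a b ha hb hab t x =
      x + (Real.cos t - 1) • (⟪a, x⟫ • a + ⟪b, x⟫ • b) + Real.sin t • planeRotationGen a b x :=
  rfl

lemma hasDerivAt_planeRotation {n : ℕ} {a b : E n} (ha : ‖a‖ = 1) (hb : ‖b‖ = 1)
    (hab : ⟪a, b⟫ = 0) (x : E n) (t : ℝ) :
    HasDerivAt (fun t => planeRotation a b ha hb hab t x)
      (-Real.sin t • (⟪a, x⟫ • a + ⟪b, x⟫ • b) + Real.cos t • planeRotationGen a b x) t := by
  simp only [planeRotation_apply]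
  exact ((((Real.hasDerivAt_cos t).sub_const 1).smul_const _).const_add x).add
    ((Real.hasDerivAt_sin t).smul_const _)

lemma setIntegral_sphere_comp_linearIsometryEquiv {n : ℕ} (R : E n ≃ₗᵢ[ℝ] E n) (f : E n → ℝ) :
    ∫ x in sphere (0 : E n) 1, f (R x) ∂μH[(n : ℝ)] =
      ∫ x in sphere (0 : E n) 1, f x ∂μH[(n : ℝ)] := by
  have h := (R.toIsometryEquiv.measurePreserving_hausdorffMeasure (n : ℝ)).setIntegral_preimage_emb
    R.toHomeomorph.measurableEmbedding f (sphere (0 : E n) 1)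
  have hpre : R.toIsometryEquiv ⁻¹' sphere (0 : E n) 1 = sphere (0 : E n) 1 := by
    ext x
    simp
  rw [hpre] at h
  exact h

lemma setIntegral_sphere_fderiv_planeRotationGen {n : ℕ} {a b : E n} (ha : ‖a‖ = 1)
    (hb : ‖b‖ = 1) (hab : ⟪a, b⟫ = 0) {G : E n → ℝ} (hG : ∀ x, x ≠ 0 → ContDiffAt ℝ 1 G x) :
    ∫ x in sphere (0 : E n) 1, fderiv ℝ G x (planeRotationGen a b x) ∂μH[(n : ℝ)] = 0 := by
  have hne {x : E n} (hx : x ∈ sphere (0 : E n) 1) : x ≠ 0 := ne_zero_of_mem_unit_sphere ⟨x, hx⟩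
  have hS : MeasurableSet (sphere (0 : E n) 1) := isClosed_sphere.measurableSet
  have hG0 : ContinuousOn G (sphere (0 : E n) 1) := fun x hx =>
    (hG x (hne hx)).continuousAt.continuousWithinAt
  have hG1 : ContinuousOn (fderiv ℝ G) (sphere (0 : E n) 1) := fun x hx =>
    ((hG x (hne hx)).fderiv_right (m := 0) (by simp)).continuousAt.continuousWithinAt
  obtain ⟨C, hC⟩ := (isCompact_sphere (0 : E n) 1).exists_bound_of_continuousOn hG1
  set R := planeRotation a b ha hb hab with hR
  have hRS (t : ℝ) {x : E n} (hx : x ∈ sphere (0 : E n) 1) : R t x ∈ sphere (0 : E n) 1 := by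
    simpa using hx
  set V : ℝ → E n → E n := fun t x =>
    -Real.sin t • (⟪a, x⟫ • a + ⟪b, x⟫ • b) + Real.cos t • planeRotationGen a b x with hV
  have hd (t : ℝ) {x : E n} (hx : x ∈ sphere (0 : E n) 1) :
      HasDerivAt (fun t => G (R t x)) (fderiv ℝ G (R t x) (V t x)) t :=
    (((hG _ (hne (hRS t hx))).differentiableAt one_ne_zero).hasFDerivAt).comp_hasDerivAt t
      (hasDerivAt_planeRotation ha hb hab x t)
  have hfin : IsFiniteMeasure ((μH[(n : ℝ)]).restrict (sphere (0 : E n) 1)) :=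
    ⟨by simpa using hausdorffMeasure_sphere_lt_top n⟩
  have hR0 (x : E n) : R 0 x = x := by simp [hR, planeRotation_apply]
  have hV0 (x : E n) : V 0 x = planeRotationGen a b x := by simp [hV]
  have hVb (t : ℝ) {x : E n} (hx : x ∈ sphere (0 : E n) 1) : ‖V t x‖ ≤ 4 := by
    have hx1 : ‖x‖ = 1 := by simpa using hx
    have h1 : |⟪a, x⟫| ≤ 1 := by simpa [ha, hx1] using abs_real_inner_le_norm a x
    have h2 : |⟪b, x⟫| ≤ 1 := by simpa [hb, hx1] using abs_real_inner_le_norm b x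
    have h3 := Real.abs_sin_le_one t
    have h4 := Real.abs_cos_le_one t
    have h5 : ‖⟪a, x⟫ • a + ⟪b, x⟫ • b‖ ≤ 2 := by
      refine (norm_add_le _ _).trans ?_
      rw [norm_smul, norm_smul, ha, hb, Real.norm_eq_abs, Real.norm_eq_abs]
      linarith
    have h6 : ‖planeRotationGen a b x‖ ≤ 2 := by
      rw [planeRotationGen_apply]
      refine (norm_sub_le _ _).trans ?_
      rw [norm_smul, norm_smul, ha, hb, Real.norm_eq_abs, Real.norm_eq_abs]
      linarith
    refine (norm_add_le _ _).trans ?_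
    rw [norm_smul, norm_smul, Real.norm_eq_abs, Real.norm_eq_abs, abs_neg]
    nlinarith [mul_le_mul h3 h5 (norm_nonneg _) zero_le_one,
      mul_le_mul h4 h6 (norm_nonneg _) zero_le_one]
  have hmeas (t : ℝ) : AEStronglyMeasurable (fun x => G (R t x))
      ((μH[(n : ℝ)]).restrict (sphere (0 : E n) 1)) :=
    (hG0.comp (R t).continuous.continuousOn fun x hx => hRS t hx).aestronglyMeasurable hS
  have key := hasDerivAt_integral_of_dominated_loc_of_deriv_le (𝕜 := ℝ)
    (μ := (μH[(n : ℝ)]).restrict (sphere (0 : E n) 1)) (F := fun t x => G (R t x))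
    (F' := fun t x => fderiv ℝ G (R t x) (V t x)) (x₀ := 0) (bound := fun _ => C * 4)
    (s := univ) univ_mem (.of_forall hmeas) ?_ ?_ ?_ (integrable_const _) ?_
  · have hconst : (fun t => ∫ x in sphere (0 : E n) 1, G (R t x) ∂μH[(n : ℝ)]) =
        fun _ => ∫ x in sphere (0 : E n) 1, G x ∂μH[(n : ℝ)] :=
      funext fun t => setIntegral_sphere_comp_linearIsometryEquiv (R t) G
    have h0 := key.2
    rw [hconst] at h0
    have h1 := h0.unique (hasDerivAt_const (0 : ℝ) _)
    simpa only [hR0, hV0] using h1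
  · simp only [hR0]
    obtain ⟨C', hC'⟩ := (isCompact_sphere (0 : E n) 1).exists_bound_of_continuousOn hG0
    refine Integrable.of_bound (hG0.aestronglyMeasurable hS) C' ?_
    filter_upwards [ae_restrict_mem hS] with x hx using hC' x hx
  · simp only [hR0, hV0]
    exact (hG1.clm_apply (planeRotationGen a b).continuous.continuousOn).aestronglyMeasurable hS
  · filter_upwards [ae_restrict_mem hS] with x hx t _
    have hC0 : 0 ≤ C := (norm_nonneg _).trans (hC x hx)
    exact (ContinuousLinearMap.le_opNorm _ _).trans
      (mul_le_mul (hC _ (hRS t hx)) (hVb t hx) (norm_nonneg _) hC0)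
  · filter_upwards [ae_restrict_mem hS] with x hx t _ using hd t hx

end Rotations

section IntegralIdentity

open Set Filter Topology

lemma integrableOn_sphere_of_continuousOn {n : ℕ} {f : E n → ℝ}
    (hf : ContinuousOn f (sphere (0 : E n) 1)) :
    IntegrableOn f (sphere (0 : E n) 1) μH[(n : ℝ)] := by
  have hS : MeasurableSet (sphere (0 : E n) 1) := isClosed_sphere.measurableSet
  have hfin : IsFiniteMeasure ((μH[(n : ℝ)]).restrict (sphere (0 : E n) 1)) :=
    ⟨by simpa using hausdorffMeasure_sphere_lt_top n⟩
  obtain ⟨C, hC⟩ := (isCompact_sphere (0 : E n) 1).exists_bound_of_continuousOn hf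
  refine Integrable.of_bound (hf.aestronglyMeasurable hS) C ?_
  filter_upwards [ae_restrict_mem hS] with x hx using hC x hx

section PlaneSums

variable {n : ℕ} (b : OrthonormalBasis (Fin (n + 1)) ℝ (E n))

lemma sum_inner_mul_inner_planeRotationGen (x p q : E n) :
    ∑ i, ∑ j, ⟪p, planeRotationGen (b i) (b j) x⟫ * ⟪q, planeRotationGen (b i) (b j) x⟫ =
      2 * (‖x‖ ^ 2 * ⟪p, q⟫ - ⟪p, x⟫ * ⟪q, x⟫) := by
  have h (i j : Fin (n + 1)) :
      ⟪p, planeRotationGen (b i) (b j) x⟫ * ⟪q, planeRotationGen (b i) (b j) x⟫ =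
      ⟪b i, x⟫ ^ 2 * (⟪p, b j⟫ * ⟪b j, q⟫) - (⟪q, b i⟫ * ⟪b i, x⟫) * (⟪p, b j⟫ * ⟪b j, x⟫) -
        (⟪p, b i⟫ * ⟪b i, x⟫) * (⟪q, b j⟫ * ⟪b j, x⟫) +
        (⟪p, b i⟫ * ⟪b i, q⟫) * ⟪b j, x⟫ ^ 2 := by
    rw [real_inner_comm q (b i), real_inner_comm q (b j)]
    simp only [planeRotationGen_apply, inner_sub_right, inner_smul_right]
    ring
  simp only [h, Finset.sum_add_distrib, Finset.sum_sub_distrib, ← Finset.sum_mul_sum,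
    b.sum_sq_inner_right, b.sum_inner_mul_inner]
  ring

lemma sum_inner_map_planeRotationGen {A : E n →L[ℝ] E n} {x : E n} (hx : ‖x‖ = 1)
    (hA : ∀ u v, ⟪A u, v⟫ = ⟪u, A v⟫) (hAx : A x = 0) :
    ∑ i, ∑ j, ⟪A (planeRotationGen (b i) (b j) x), planeRotationGen (b i) (b j) x⟫ =
      2 * LinearMap.trace ℝ (E n) A.toLinearMap := by
  have hcross (i : Fin (n + 1)) : ∑ j, ⟪A (b i), b j⟫ * ⟪b j, x⟫ = 0 := by
    rw [b.sum_inner_mul_inner, hA, hAx, inner_zero_right]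
  have h (i j : Fin (n + 1)) :
      ⟪A (planeRotationGen (b i) (b j) x), planeRotationGen (b i) (b j) x⟫ =
      ⟪b i, x⟫ ^ 2 * ⟪b j, A (b j)⟫ - 2 * ⟪b i, x⟫ * (⟪A (b i), b j⟫ * ⟪b j, x⟫) +
        ⟪b i, A (b i)⟫ * ⟪b j, x⟫ ^ 2 := by
    have h1 : ⟪A (b j), b i⟫ = ⟪A (b i), b j⟫ := by rw [hA, real_inner_comm]
    simp only [planeRotationGen_apply, map_sub, map_smul, inner_sub_left, inner_sub_right,
      inner_smul_left, inner_smul_right, conj_trivial, h1, ← hA]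
    ring
  simp only [h, Finset.sum_add_distrib, Finset.sum_sub_distrib, ← Finset.mul_sum, hcross,
    ← Finset.sum_mul, b.sum_sq_inner_right, LinearMap.trace_eq_sum_inner _ b, hx,
    ContinuousLinearMap.coe_coe]
  simp
  ring

lemma sum_inner_planeRotationGen_planeRotationGen (x p : E n) :
    ∑ i, ∑ j, ⟪p, planeRotationGen (b i) (b j) (planeRotationGen (b i) (b j) x)⟫ =
      -(2 * n) * ⟪p, x⟫ := by
  have h (i j : Fin (n + 1)) :
      ⟪p, planeRotationGen (b i) (b j) (planeRotationGen (b i) (b j) x)⟫ =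
      2 * (if i = j then ⟪p, b i⟫ * ⟪b i, x⟫ else 0) - ⟪p, b j⟫ * ⟪b j, x⟫ -
        ⟪p, b i⟫ * ⟪b i, x⟫ := by
    have h1 (i : Fin (n + 1)) : ⟪b i, b i⟫ = 1 := by simp
    have h2 : ⟪b j, b i⟫ = ⟪b i, b j⟫ := real_inner_comm _ _
    simp only [planeRotationGen_apply, inner_sub_right, inner_smul_right, h1, h2,
      b.inner_eq_ite i j]
    split_ifs with hij
    · subst hij; ring
    · ring
  simp only [h, Finset.sum_sub_distrib, ← Finset.mul_sum, Finset.sum_ite_eq, Finset.mem_univ,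
    if_true, b.sum_inner_mul_inner, Finset.sum_const, Finset.card_univ, Fintype.card_fin,
    nsmul_eq_mul]
  simp only [mul_left_comm _ (((n + 1 : ℕ)) : ℝ)]
  rw [← Finset.mul_sum, b.sum_inner_mul_inner]
  push_cast
  ring

end PlaneSums

namespace IsSupportFunction

variable {n : ℕ} {H : E n → ℝ} (hs : IsSupportFunction H) {x : E n}
include hs

lemma contDiffAt_sq_mul_sigmaDet (hx : x ≠ 0) :
    ContDiffAt ℝ (⊤ : ℕ∞) (fun y => H y ^ 2 * sigmaDet H y) x :=
  ((hs.contDiffAt hx).pow 2).mul (hs.contDiffAt_sigmaDet hx)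

lemma contDiffAt_inner_gradient_planeRotationGen (hx : x ≠ 0) (a b : E n) :
    ContDiffAt ℝ (⊤ : ℕ∞) (fun y => ⟪gradient H y, planeRotationGen a b y⟫) x :=
  (hs.contDiffAt_gradient hx).inner ℝ (planeRotationGen a b).contDiff.contDiffAt

lemma fderiv_planeRotationGen (hx : x ≠ 0) (a b : E n) :
    fderiv ℝ (fun y => (H y ^ 2 * sigmaDet H y) * ⟪gradient H y, planeRotationGen a b y⟫) x
      (planeRotationGen a b x) =
    ⟪gradient (fun y => H y ^ 2 * sigmaDet H y) x, planeRotationGen a b x⟫ *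
        ⟪gradient H x, planeRotationGen a b x⟫ +
      H x ^ 2 * sigmaDet H x * (⟪hess H x (planeRotationGen a b x), planeRotationGen a b x⟫ +
        ⟪gradient H x, planeRotationGen a b (planeRotationGen a b x)⟫) := by
  have h1 := ((hs.contDiffAt_sq_mul_sigmaDet hx).differentiableAt (by simp)).hasFDerivAt
  have h2 := (hs.hasFDerivAt_gradient hx).inner ℝ (planeRotationGen a b).hasFDerivAt
  rw [(h1.fun_mul h2).fderiv, inner_gradient_left]
  simp
  ring

lemma inner_gradient_sq_mul_sigmaDet (hx : x ≠ 0) (v : E n) :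
    ⟪gradient (fun y => H y ^ 2 * sigmaDet H y) x, v⟫ =
      2 * H x * sigmaDet H x * ⟪gradient H x, v⟫ + H x ^ 2 * ⟪gradient (sigmaDet H) x, v⟫ := by
  have h1 := (hs.differentiableAt hx).hasFDerivAt
  have h2 := ((hs.contDiffAt_sigmaDet hx).differentiableAt (by simp)).hasFDerivAt
  have h3 : HasFDerivAt (fun y => H y ^ 2 * sigmaDet H y) _ x := (h1.pow 2).fun_mul h2
  rw [inner_gradient_left, inner_gradient_left, inner_gradient_left, h3.fderiv]
  simp
  ring

lemma inner_gradient_log (hx : x ∈ sphere (0 : E n) 1) (v : E n) :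
    ⟪gradient (fun y => Real.log (H y ^ (n + 2) * sigmaDet H y)) x, v⟫ =
      (n + 2) * ⟪gradient H x, v⟫ / H x + ⟪gradient (sigmaDet H) x, v⟫ / sigmaDet H x := by
  have hx0 : x ≠ 0 := ne_zero_of_mem_unit_sphere ⟨x, hx⟩
  have hH := hs.pos hx0
  have hσ := hs.sigmaDet_pos hx
  have h1 := (hs.differentiableAt hx0).hasFDerivAt
  have h2 := ((hs.contDiffAt_sigmaDet hx0).differentiableAt (by simp)).hasFDerivAt
  have h3 : HasFDerivAt (fun y => H y ^ (n + 2) * sigmaDet H y) _ x :=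
    (h1.pow (n + 2)).fun_mul h2
  rw [inner_gradient_left, inner_gradient_left, inner_gradient_left,
    (h3.log (by positivity)).fderiv]
  simp
  field_simp
  ring

lemma sum_fderiv_planeRotationGen (hx : x ∈ sphere (0 : E n) 1)
    (b : OrthonormalBasis (Fin (n + 1)) ℝ (E n)) :
    ∑ i, ∑ j, fderiv ℝ (fun y => (H y ^ 2 * sigmaDet H y) *
        ⟪gradient H y, planeRotationGen (b i) (b j) y⟫) x (planeRotationGen (b i) (b j) x) =
      2 * (⟪H x • gradient H x,
          tgrad (fun y => Real.log ((H y) ^ (n + 2) * sigmaDet H y)) x⟫ * (H x * sigmaDet H x) -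
        ((n : ℝ) * ‖tgrad H x‖ ^ 2 -
          H x * (LinearMap.trace ℝ (E n) (hess H x).toLinearMap - (n : ℝ) * H x)) *
          (H x * sigmaDet H x)) := by
  have hx0 : x ≠ 0 := ne_zero_of_mem_unit_sphere ⟨x, hx⟩
  have hx1 : ‖x‖ = 1 := by simpa using hx
  have hH := hs.pos hx0
  have hσ := hs.sigmaDet_pos hx
  simp only [hs.fderiv_planeRotationGen hx0, Finset.sum_add_distrib, ← Finset.mul_sum]
  rw [sum_inner_mul_inner_planeRotationGen, sum_inner_map_planeRotationGen b hx1
    (hs.hess_symm hx0) (hs.hess_self hx0), sum_inner_planeRotationGen_planeRotationGen, hx1,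
    hs.norm_tgrad_sq hx, tgrad, inner_smul_left, inner_sub_right, inner_smul_right,
    real_inner_comm (gradient (fun y => Real.log _) x) (gradient H x),
    hs.inner_gradient_log hx, hs.inner_gradient_log hx, hs.inner_gradient_sq_mul_sigmaDet hx0,
    hs.inner_gradient_sq_mul_sigmaDet hx0, hs.inner_gradient_self hx0, real_inner_self_eq_norm_sq]
  simp only [conj_trivial]
  field_simp
  ring

lemma continuousOn_tgrad : ContinuousOn (tgrad H) {(0 : E n)}ᶜ :=
  hs.continuousOn_gradient.fun_sub
    ((hs.continuousOn_gradient.inner continuousOn_id).fun_smul continuousOn_id)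

lemma continuousOn_trace_hess :
    ContinuousOn (fun x => LinearMap.trace ℝ (E n) (hess H x).toLinearMap) {(0 : E n)}ᶜ := by
  simp only [LinearMap.trace_eq_sum_inner _ (EuclideanSpace.basisFun (Fin (n + 1)) ℝ)]
  exact continuousOn_finsetSum _ fun i _ =>
    continuousOn_const.inner (hs.continuousOn_hess.clm_apply continuousOn_const)

lemma setIntegral_sphere_inner_tgrad_log_eq :
    ∫ x in sphere (0 : E n) 1,
        ⟪H x • gradient H x,
          tgrad (fun y => Real.log ((H y) ^ (n + 2) * sigmaDet H y)) x⟫ *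
          (H x * sigmaDet H x) ∂μH[(n : ℝ)] =
      ∫ x in sphere (0 : E n) 1,
        ((n : ℝ) * ‖tgrad H x‖ ^ 2 -
          H x * (LinearMap.trace ℝ (E n) (hess H x).toLinearMap - (n : ℝ) * H x)) *
          (H x * sigmaDet H x) ∂μH[(n : ℝ)] := by
  set b := EuclideanSpace.basisFun (Fin (n + 1)) ℝ
  have hS : MeasurableSet (sphere (0 : E n) 1) := isClosed_sphere.measurableSet
  have hne {x : E n} (hx : x ∈ sphere (0 : E n) 1) : x ≠ 0 := ne_zero_of_mem_unit_sphere ⟨x, hx⟩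
  set G : Fin (n + 1) → Fin (n + 1) → E n → ℝ := fun i j y =>
    (H y ^ 2 * sigmaDet H y) * ⟪gradient H y, planeRotationGen (b i) (b j) y⟫ with hG
  have hGd (i j) (x : E n) (hx : x ≠ 0) : ContDiffAt ℝ 1 (G i j) x :=
    ((hs.contDiffAt_sq_mul_sigmaDet hx).mul
      (hs.contDiffAt_inner_gradient_planeRotationGen hx (b i) (b j))).of_le (by simp)
  have hGi (i j) : IntegrableOn (fun x => fderiv ℝ (G i j) x (planeRotationGen (b i) (b j) x))
      (sphere (0 : E n) 1) μH[(n : ℝ)] := by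
    refine integrableOn_sphere_of_continuousOn (ContinuousOn.clm_apply (fun x hx => ?_)
      (planeRotationGen (b i) (b j)).continuous.continuousOn)
    exact ((hGd i j x (hne hx)).fderiv_right (m := 0) (by simp)).continuousAt.continuousWithinAt
  have hG0 (i j) : ∫ x in sphere (0 : E n) 1,
      fderiv ℝ (G i j) x (planeRotationGen (b i) (b j) x) ∂μH[(n : ℝ)] = 0 := by
    by_cases hij : i = j
    · subst hij
      simp [planeRotationGen_apply]
    · exact setIntegral_sphere_fderiv_planeRotationGen (b.orthonormal.1 i) (b.orthonormal.1 j)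
        (b.orthonormal.2 hij) (hGd i j)
  have hsum : ∫ x in sphere (0 : E n) 1, 2⁻¹ * ∑ i, ∑ j,
      fderiv ℝ (G i j) x (planeRotationGen (b i) (b j) x) ∂μH[(n : ℝ)] = 0 := by
    rw [integral_const_mul,
      integral_finsetSum _ fun i _ => integrable_finsetSum _ fun j _ => hGi i j]
    have h (i) : ∫ x in sphere (0 : E n) 1, ∑ j,
        fderiv ℝ (G i j) x (planeRotationGen (b i) (b j) x) ∂μH[(n : ℝ)] = 0 := by
      rw [integral_finsetSum _ fun j _ => hGi i j]
      simp only [hG0, Finset.sum_const_zero]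
    simp only [h, Finset.sum_const_zero, mul_zero]
  have hR : IntegrableOn (fun x => ((n : ℝ) * ‖tgrad H x‖ ^ 2 -
      H x * (LinearMap.trace ℝ (E n) (hess H x).toLinearMap - (n : ℝ) * H x)) *
        (H x * sigmaDet H x)) (sphere (0 : E n) 1) μH[(n : ℝ)] := by
    have hH : ContinuousOn H {(0 : E n)}ᶜ := hs.smooth.continuousOn
    refine integrableOn_sphere_of_continuousOn (ContinuousOn.mono ?_ fun x hx => hne hx)
    exact ((continuousOn_const.mul (hs.continuousOn_tgrad.norm.pow 2)).sub
      (hH.mul (hs.continuousOn_trace_hess.sub (continuousOn_const.mul hH)))).mul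
      (hH.mul hs.continuousOn_sigmaDet)
  rw [← add_zero (∫ x in sphere (0 : E n) 1, (_ - _) * _ ∂μH[(n : ℝ)]), ← hsum,
    ← integral_add hR
      ((integrable_finsetSum _ fun i _ => integrable_finsetSum _ fun j _ => hGi i j).const_mul _)]
  refine setIntegral_congr_fun hS fun x hx => ?_
  simp only [hG, hs.sum_fderiv_planeRotationGen hx b]
  ring

end IsSupportFunction

end IntegralIdentity

/-- For an origin-centred smooth strictly convex body,
`∫ ⟨hX, ∇̄ log(h^{n+2}/𝒦)⟩ dV = ∫ (n|∇̄h|² - h Δ̄h) dV ≤ 0`, where `X = Dh`,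
`dV = h σ_n dμ`, and `Δ̄h = trace D²H - n h` on the unit sphere. -/
theorem stmt18 (n : ℕ) (H : E n → ℝ)
    (hhom : ∀ (t : ℝ) (x : E n), 0 < t → H (t • x) = t * H x)
    (hsmooth : ContDiffOn ℝ (⊤ : ℕ∞) H {(0 : E n)}ᶜ)
    (hpos : ∀ x ∈ sphere (0 : E n) 1, 0 < H x)
    (hconvex : ∀ x ∈ sphere (0 : E n) 1, ∀ v : E n, ⟪v, x⟫ = 0 → v ≠ 0 →
      0 < ⟪(hess H x) v, v⟫)
    (hcentroid : ∫ y in body H, y = 0) :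
    (∫ x in sphere (0 : E n) 1,
        ⟪H x • gradient H x,
          tgrad (fun y => Real.log ((H y) ^ (n + 2) * sigmaDet H y)) x⟫ *
          (H x * sigmaDet H x) ∂μH[(n : ℝ)]) =
      (∫ x in sphere (0 : E n) 1,
        ((n : ℝ) * ‖tgrad H x‖ ^ 2 -
          H x * (LinearMap.trace ℝ (E n) (hess H x).toLinearMap - (n : ℝ) * H x)) *
          (H x * sigmaDet H x) ∂μH[(n : ℝ)]) ∧
    (∫ x in sphere (0 : E n) 1,
        ((n : ℝ) * ‖tgrad H x‖ ^ 2 -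
          H x * (LinearMap.trace ℝ (E n) (hess H x).toLinearMap - (n : ℝ) * H x)) *
          (H x * sigmaDet H x) ∂μH[(n : ℝ)]) ≤ 0 := by
  have hs : IsSupportFunction H := ⟨hhom, hsmooth, hpos, hconvex⟩
  exact ⟨hs.setIntegral_sphere_inner_tgrad_log_eq, hs.setIntegral_sphere_nonpos hcentroid⟩

end
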